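/- arXiv:2401.12581 — 5 statements merged into one kernel-verified Lean document; each statement's English description precedes it below -/
import Mathlib

section
/- Fix j ∈ ℕ, set γ_{j,i} = r_{j−i}/r_j for i = 0, 1, …, j, and let I_{j,i} = [γ_{j,i}, γ_{j,i+1}] for 0 ≤ i ≤ j − 1 and I_{j,j} = [γ_{j,j}, ∞). Then for every i ∈ {0, …, j} and every continuously differentiable function f : I_{j,i} → ℝ vanishing at the endpoints of I_{j,i} (and, in the case i = j, with compact support) that satisfies the orthogonality condition ∫_{I_{j,i}} f'(r)·Q_j'(r)·r² dr = 0, one has ∫_{I_{j,i}} f'(r)²·r² dr ≥ (2m+1)·∫_{I_{j,i}} Q_j(r)^{2m}·f(r)²·r² dr. -/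
open Set Filter MeasureTheory

open scoped Topology

/-- `Q` is a radial solution of `Q'' + (2 / r) Q' + Q ^ (2m+1) = 0` on `(0, ∞)`, with derivative
`P`. -/
structure IsRadialSolution (m : ℕ) (Q P : ℝ → ℝ) : Prop where
  hasDerivAt : ∀ r > 0, HasDerivAt Q (P r) r
  hasDerivAt_deriv : ∀ r > 0, HasDerivAt P (-(2 / r) * P r - Q r ^ (2 * m + 1)) r

/-- The generator `r Q' + Q / m` of the scaling symmetry. -/
noncomputable def scalingMode (m : ℕ) (Q P : ℝ → ℝ) (r : ℝ) : ℝ := r * P r + Q r / m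

/-- The derivative of `scalingMode` along a radial solution. -/
noncomputable def scalingModeDeriv (m : ℕ) (Q P : ℝ → ℝ) (r : ℝ) : ℝ :=
  -(1 - 1 / (m : ℝ)) * P r - r * Q r ^ (2 * m + 1)

/-- The energy of the autonomous equation satisfied by `r ^ (1 / m) * Q r` in the variable
`log r`. -/
noncomputable def emdenFowlerEnergy (m : ℕ) (Q P : ℝ → ℝ) (r : ℝ) : ℝ :=
  r ^ (2 / (m : ℝ)) * (scalingMode m Q P r ^ 2 / 2 - (1 / (m : ℝ) * (1 - 1 / (m : ℝ))) * Q r ^ 2 / 2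
    + r ^ 2 * Q r ^ (2 * m + 2) / (2 * m + 2))

/-- A function whose derivative is negative wherever it vanishes cannot return to zero. -/
lemma neg_of_nonpos_of_deriv_neg_at_zeros {h h' : ℝ → ℝ} {c x : ℝ} (hcx : c < x)
    (hh : ∀ r ∈ Icc c x, HasDerivAt h (h' r) r) (hneg : ∀ r ∈ Icc c x, h r = 0 → h' r < 0)
    (hc : h c ≤ 0) : h x < 0 := by
  have hle : ∀ ⦃r⦄, r ∈ Icc c x → h r ≤ 0 := by
    refine image_le_of_deriv_right_lt_deriv_boundary (f := h) (f' := h') (B := fun _ => 0)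
      (B' := fun _ => 0) (fun r hr => (hh r hr).continuousAt.continuousWithinAt)
      (fun r hr => (hh r (Ico_subset_Icc_self hr)).hasDerivWithinAt) hc
      (fun r => hasDerivAt_const r 0) (fun r hr h0 => hneg r (Ico_subset_Icc_self hr) h0)
  have hx : x ∈ Icc c x := right_mem_Icc.2 hcx.le
  refine (hle hx).lt_of_ne fun h0 => ?_
  have hslope : Tendsto (slope h x) (𝓝[<] x) (𝓝 (h' x)) :=
    (hasDerivAt_iff_tendsto_slope.1 (hh x hx)).mono_left
      (nhdsWithin_mono _ fun y hy => ne_of_lt hy)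
  have hev := hslope.eventually (gt_mem_nhds (hneg x hx h0))
  obtain ⟨y, hy, hyc⟩ := (hev.and (Ioo_mem_nhdsLT hcx)).exists
  have hyle := hle (Ioo_subset_Icc_self hyc)
  rw [slope_def_field, h0] at hy
  have : 0 ≤ (h y - 0) / (y - x) := div_nonneg_of_nonpos (by linarith) (by linarith [hyc.2])
  linarith

namespace IsRadialSolution

variable {m : ℕ} {Q P : ℝ → ℝ}

lemma neg (hQ : IsRadialSolution m Q P) :
    IsRadialSolution m (fun r => -Q r) (fun r => -P r) where
  hasDerivAt r hr := (hQ.hasDerivAt r hr).neg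
  hasDerivAt_deriv r hr := by
    refine (hQ.hasDerivAt_deriv r hr).neg.congr_deriv ?_
    rw [Odd.neg_pow ⟨m, rfl⟩]
    ring

lemma hasDerivAt_scalingMode (hQ : IsRadialSolution m Q P) {r : ℝ} (hr : 0 < r) :
    HasDerivAt (scalingMode m Q P) (scalingModeDeriv m Q P r) r := by
  have h := ((hasDerivAt_id r).mul (hQ.hasDerivAt_deriv r hr)).add
    ((hQ.hasDerivAt r hr).div_const (m : ℝ))
  refine h.congr_deriv ?_
  simp only [scalingModeDeriv, id]
  field_simp
  ring

lemma hasDerivAt_sq_mul_scalingModeDeriv (hm : m ≠ 0) (hQ : IsRadialSolution m Q P) {r : ℝ}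
    (hr : 0 < r) : HasDerivAt (fun r => r ^ 2 * scalingModeDeriv m Q P r)
      (-(2 * m + 1) * r ^ 2 * Q r ^ (2 * m) * scalingMode m Q P r) r := by
  have h := ((hasDerivAt_id r).pow 2).mul (((hQ.hasDerivAt_deriv r hr).const_mul
    (-(1 - 1 / (m : ℝ)))).sub ((hasDerivAt_id r).mul ((hQ.hasDerivAt r hr).pow (2 * m + 1))))
  refine h.congr_deriv ?_
  have hm' : (m : ℝ) ≠ 0 := by exact_mod_cast hm
  simp only [scalingMode, id, Pi.pow_apply, Pi.sub_apply, Pi.mul_apply]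
  simp only [add_tsub_cancel_right]
  push_cast
  field_simp
  ring

lemma hasDerivAt_sq_mul_deriv (hQ : IsRadialSolution m Q P) {r : ℝ} (hr : 0 < r) :
    HasDerivAt (fun r => r ^ 2 * P r) (-r ^ 2 * Q r ^ (2 * m + 1)) r := by
  refine (((hasDerivAt_id r).pow 2).mul (hQ.hasDerivAt_deriv r hr)).congr_deriv ?_
  simp only [id, Pi.pow_apply]
  field_simp
  ring

lemma hasDerivAt_emdenFowlerEnergy (hm : m ≠ 0) (hQ : IsRadialSolution m Q P) {r : ℝ}
    (hr : 0 < r) : HasDerivAt (emdenFowlerEnergy m Q P)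
      (-(1 - 2 / (m : ℝ)) * r ^ (2 / (m : ℝ)) / r * scalingMode m Q P r ^ 2) r := by
  have hw := hQ.hasDerivAt_scalingMode hr
  have h1 := Real.hasDerivAt_rpow_const (p := 2 / (m : ℝ)) (Or.inl hr.ne')
  have h := h1.mul ((((hw.pow 2).div_const 2).sub
    ((((hQ.hasDerivAt r hr).pow 2).const_mul (1 / (m : ℝ) * (1 - 1 / (m : ℝ)))).div_const 2)).add
      ((((hasDerivAt_id r).pow 2).mul ((hQ.hasDerivAt r hr).pow (2 * m + 2))).div_const
        (2 * m + 2 : ℝ)))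
  refine h.congr_deriv ?_
  have hm' : (m : ℝ) ≠ 0 := by exact_mod_cast hm
  have hm2 : (2 * m + 2 : ℝ) ≠ 0 := by positivity
  have hm3 : (m + 1 : ℝ) ≠ 0 := by positivity
  rw [Real.rpow_sub_one hr.ne']
  simp only [scalingMode, scalingModeDeriv, id, Pi.pow_apply, Pi.sub_apply, Pi.mul_apply,
    Pi.add_apply]
  simp only [show 2 * m + 2 - 1 = 2 * m + 1 by omega]
  push_cast
  field_simp
  ring

lemma energy_antitone (hm : 2 < m) (hQ : IsRadialSolution m Q P) :
    AntitoneOn (emdenFowlerEnergy m Q P) (Ioi 0) := by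
  have hm2 : (2 : ℝ) < m := by exact_mod_cast hm
  refine antitoneOn_of_hasDerivWithinAt_nonpos (convex_Ioi 0)
    (fun r hr => (hQ.hasDerivAt_emdenFowlerEnergy (by omega) hr).continuousAt.continuousWithinAt)
    (fun r hr => (hQ.hasDerivAt_emdenFowlerEnergy (by omega)
      (by simpa using hr)).hasDerivWithinAt) fun r hr => ?_
  rw [interior_Ioi] at hr
  have hr : 0 < r := hr
  have h1 : 2 / (m : ℝ) < 1 := by rw [div_lt_one (by linarith)]; exact hm2
  have h2 : 0 ≤ (1 - 2 / (m : ℝ)) * r ^ (2 / (m : ℝ)) / r * scalingMode m Q P r ^ 2 := by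
    have : 0 ≤ 1 - 2 / (m : ℝ) := by linarith
    positivity
  linarith [show -(1 - 2 / (m : ℝ)) * r ^ (2 / (m : ℝ)) / r * scalingMode m Q P r ^ 2
    = -((1 - 2 / (m : ℝ)) * r ^ (2 / (m : ℝ)) / r * scalingMode m Q P r ^ 2) by ring]

/-- Where the energy is nonnegative, the scaling mode crosses zero downwards. -/
lemma scalingModeDeriv_neg (hm : 2 < m) {r : ℝ} (hr : 0 < r)
    (hpos : 0 < Q r) (hE : 0 ≤ emdenFowlerEnergy m Q P r) (hw : scalingMode m Q P r = 0) :
    scalingModeDeriv m Q P r < 0 := by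
  have hm2 : (2 : ℝ) < m := by exact_mod_cast hm
  have hm0 : (0 : ℝ) < m := by linarith
  set β : ℝ := 1 / (m : ℝ) * (1 - 1 / (m : ℝ)) with hβ
  have hβpos : 0 < β := by
    have : 1 / (m : ℝ) < 1 := by rw [div_lt_one hm0]; linarith
    have : 0 < 1 - 1 / (m : ℝ) := by linarith
    positivity
  unfold emdenFowlerEnergy at hE
  rw [hw] at hE
  have hE' := nonneg_of_mul_nonneg_right hE (Real.rpow_pos_of_pos hr _)
  have hkey : β * (m + 1) ≤ r ^ 2 * Q r ^ (2 * m) := by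
    have h1 : 0 ≤ Q r ^ 2 * (r ^ 2 * Q r ^ (2 * m) - β * (m + 1)) := by
      have h2 := mul_nonneg hE' (show (0 : ℝ) ≤ 2 * m + 2 by positivity)
      have h3 : (0 ^ 2 / 2 - β * Q r ^ 2 / 2 + r ^ 2 * Q r ^ (2 * m + 2) / (2 * m + 2))
          * (2 * m + 2 : ℝ) = Q r ^ 2 * (r ^ 2 * Q r ^ (2 * m) - β * (m + 1)) := by
        field_simp
        ring
      rwa [h3] at h2
    linarith [nonneg_of_mul_nonneg_right h1 (by positivity : (0 : ℝ) < Q r ^ 2)]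
  have hrw : r * scalingModeDeriv m Q P r = Q r * (β - r ^ 2 * Q r ^ (2 * m)) := by
    have hP : r * P r = -(Q r / m) := by unfold scalingMode at hw; linarith
    have : r * scalingModeDeriv m Q P r
        = -(1 - 1 / (m : ℝ)) * (r * P r) - r ^ 2 * Q r ^ (2 * m + 1) := by
      unfold scalingModeDeriv; ring
    rw [this, hP, hβ]
    ring
  have hlt : Q r * (β - r ^ 2 * Q r ^ (2 * m)) < 0 :=
    mul_neg_of_pos_of_neg hpos (by nlinarith)
  rw [← hrw] at hlt
  exact (pos_iff_neg_of_mul_neg hlt).1 hr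

lemma scalingMode_neg_of_nonpos (hm : 2 < m) (hQ : IsRadialSolution m Q P) {c x : ℝ}
    (hc : 0 < c) (hcx : c < x) (hpos : ∀ r ∈ Icc c x, 0 < Q r)
    (hE : ∀ r ∈ Icc c x, 0 ≤ emdenFowlerEnergy m Q P r) (hwc : scalingMode m Q P c ≤ 0) :
    scalingMode m Q P x < 0 :=
  neg_of_nonpos_of_deriv_neg_at_zeros hcx
    (fun _ hr => hQ.hasDerivAt_scalingMode (hc.trans_le hr.1))
    (fun r hr hw => scalingModeDeriv_neg hm (hc.trans_le hr.1) (hpos r hr) (hE r hr) hw)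
    hwc

/-- On an interval of positivity the scaling mode has exactly one zero. -/
lemma exists_scalingMode_zero (hm : 2 < m) (hQ : IsRadialSolution m Q P) {a R : ℝ}
    (ha : 0 < a) (haR : a < R) (hpos : ∀ r ∈ Ioo a R, 0 < Q r)
    (hE : ∀ r ∈ Ioo a R, 0 ≤ emdenFowlerEnergy m Q P r) (hwa : 0 < scalingMode m Q P a)
    (hwR : scalingMode m Q P R < 0) :
    ∃ c ∈ Ioo a R, scalingMode m Q P c = 0 ∧ scalingModeDeriv m Q P c < 0 ∧
      (∀ r ∈ Ico a c, 0 < scalingMode m Q P r) ∧ ∀ r ∈ Ioc c R, scalingMode m Q P r < 0 := by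
  obtain ⟨c, hc, hwc⟩ := intermediate_value_Ioo' haR.le
    (fun r hr => (hQ.hasDerivAt_scalingMode (ha.trans_le hr.1)).continuousAt.continuousWithinAt)
    ⟨hwR, hwa⟩
  have key : ∀ s ∈ Ioo a R, ∀ t ∈ Ioo a R, s < t → scalingMode m Q P s ≤ 0 →
      scalingMode m Q P t < 0 := fun s hs t ht hst hws =>
    hQ.scalingMode_neg_of_nonpos hm (ha.trans hs.1) hst
      (fun r hr => hpos r ⟨hs.1.trans_le hr.1, hr.2.trans_lt ht.2⟩)
      (fun r hr => hE r ⟨hs.1.trans_le hr.1, hr.2.trans_lt ht.2⟩) hws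
  refine ⟨c, hc, hwc, scalingModeDeriv_neg hm (ha.trans hc.1) (hpos c hc) (hE c hc) hwc,
    fun r hr => ?_, fun r hr => ?_⟩
  · rcases hr.1.eq_or_lt with rfl | har
    · exact hwa
    · by_contra! hle
      exact (key r ⟨har, hr.2.trans hc.2⟩ c hc hr.2 hle).ne hwc
  · rcases hr.2.eq_or_lt with rfl | hrR
    · exact hwR
    · exact key c hc r ⟨hc.1.trans hr.1, hrR⟩ hr.1 hwc.le

lemma hasDerivAt_mul_deriv_add (hQ : IsRadialSolution m Q P) {r : ℝ} (hr : 0 < r) :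
    HasDerivAt (fun r => r * P r + Q r) (-r * Q r ^ (2 * m + 1)) r := by
  refine (((hasDerivAt_id r).mul (hQ.hasDerivAt_deriv r hr)).add
    (hQ.hasDerivAt r hr)).congr_deriv ?_
  simp only [id]
  field_simp
  ring

lemma strictAntiOn_mul_deriv_add (hQ : IsRadialSolution m Q P) {a R : ℝ} (ha : 0 < a)
    (hpos : ∀ r ∈ Ioo a R, 0 < Q r) : StrictAntiOn (fun r => r * P r + Q r) (Icc a R) := by
  refine strictAntiOn_of_hasDerivWithinAt_neg (f' := fun r => -r * Q r ^ (2 * m + 1))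
    (convex_Icc a R)
    (fun r hr => (hQ.hasDerivAt_mul_deriv_add (ha.trans_le hr.1)).continuousAt.continuousWithinAt)
    (fun r hr => ?_) fun r hr => ?_
  · rw [interior_Icc] at hr
    exact (hQ.hasDerivAt_mul_deriv_add (ha.trans hr.1)).hasDerivWithinAt
  · rw [interior_Icc] at hr
    have := ha.trans hr.1
    have := hpos r hr
    have : 0 < r * Q r ^ (2 * m + 1) := by positivity
    linarith

lemma exists_slope_eq (hQ : IsRadialSolution m Q P) {x y : ℝ} (hx : 0 < x) (hxy : x < y) :
    ∃ ξ ∈ Ioo x y, ξ * P ξ + Q ξ = (y * Q y - x * Q x) / (y - x) :=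
  exists_hasDerivAt_eq_slope (fun r => r * Q r) (fun r => r * P r + Q r) hxy
    (fun r hr => (continuousAt_id.mul
      (hQ.hasDerivAt r (hx.trans_le hr.1)).continuousAt).continuousWithinAt)
    (fun r hr => (((hasDerivAt_id r).mul (hQ.hasDerivAt r (hx.trans hr.1))).congr_deriv
      (by simp only [id]; ring)))

lemma scalingMode_left_pos (hQ : IsRadialSolution m Q P) {a R : ℝ} (ha : 0 < a)
    (haR : a < R) (hpos : ∀ r ∈ Ioo a R, 0 < Q r) (hQa : Q a = 0) :
    0 < scalingMode m Q P a := by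
  obtain ⟨x, hx⟩ := exists_between haR
  obtain ⟨ξ, hξ, hξe⟩ := hQ.exists_slope_eq ha hx.1
  have h1 : 0 < (x * Q x - a * Q a) / (x - a) := by
    have := hpos x hx
    have := ha.trans hx.1
    rw [hQa, mul_zero, sub_zero]
    exact div_pos (by positivity) (by linarith [hx.1])
  have h2 := hQ.strictAntiOn_mul_deriv_add ha hpos (left_mem_Icc.2 haR.le)
    ⟨hξ.1.le, (hξ.2.trans hx.2).le⟩ hξ.1
  simp only [hQa, add_zero] at h2
  simp only [scalingMode, hQa, zero_div, add_zero]
  linarith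

lemma scalingMode_right_neg (hQ : IsRadialSolution m Q P) {a R : ℝ} (ha : 0 < a)
    (haR : a < R) (hpos : ∀ r ∈ Ioo a R, 0 < Q r) (hQR : Q R = 0) :
    scalingMode m Q P R < 0 := by
  obtain ⟨x, hx⟩ := exists_between haR
  obtain ⟨ξ, hξ, hξe⟩ := hQ.exists_slope_eq (ha.trans hx.1) hx.2
  have h1 : (R * Q R - x * Q x) / (R - x) < 0 := by
    have := hpos x hx
    have := ha.trans hx.1
    rw [hQR, mul_zero, zero_sub]
    exact div_neg_of_neg_of_pos (neg_neg_of_pos (by positivity)) (by linarith [hx.2])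
  have h2 := hQ.strictAntiOn_mul_deriv_add ha hpos
    ⟨(hx.1.trans hξ.1).le, hξ.2.le⟩ (right_mem_Icc.2 haR.le) hξ.2
  simp only [hQR, add_zero] at h2
  simp only [scalingMode, hQR, zero_div, add_zero]
  linarith

lemma energy_nonneg_of_zero {R : ℝ} (hR : 0 < R) (hQR : Q R = 0) :
    0 ≤ emdenFowlerEnergy m Q P R := by
  simp only [emdenFowlerEnergy, hQR]
  have : (0 : ℝ) ^ (2 * m + 2) = 0 := zero_pow (by omega)
  rw [this]
  have := Real.rpow_nonneg hR.le (2 / (m : ℝ))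
  ring_nf
  positivity

/-- Picone's identity for the scaling mode, integrated over `[a, R]`. -/
lemma picone (hm : m ≠ 0) (hQ : IsRadialSolution m Q P) {a c R : ℝ} (ha : 0 < a)
    (hac : a < c) (hcR : c < R) (hQa : Q a = 0) (hQc : Q c ≠ 0)
    (hwc : scalingMode m Q P c = 0) (hw'c : scalingModeDeriv m Q P c ≠ 0)
    (hw : ∀ r ∈ Icc a R, r ≠ c → scalingMode m Q P r ≠ 0)
    {f : ℝ → ℝ} (hf : ContDiffOn ℝ 1 f (Icc a R)) (hfa : f a = 0) (hfR : f R = 0)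
    (horth : ∫ r in a..R, deriv f r * P r * r ^ 2 = 0) :
    (f c / Q c) ^ 2 * (Q R / scalingMode m Q P R *
        (R ^ 2 * (Q R * scalingModeDeriv m Q P R - P R * scalingMode m Q P R)))
      ≤ (∫ r in a..R, (deriv f r) ^ 2 * r ^ 2)
        - (2 * m + 1) * ∫ r in a..R, Q r ^ (2 * m) * f r ^ 2 * r ^ 2 := by
  have haR : a < R := hac.trans hcR
  have hcmem : c ∈ Ioo a R := ⟨hac, hcR⟩
  have hrpos : ∀ r ∈ Icc a R, 0 < r := fun r hr => ha.trans_le hr.1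
  set t := f c / Q c with ht
  set w := scalingMode m Q P with hwdef
  set w' := scalingModeDeriv m Q P with hw'def
  set g : ℝ → ℝ := fun r => f r - t * Q r with hg
  obtain ⟨f', hf'⟩ : ∃ f' : ℝ → ℝ, f' = derivWithin f (Icc a R) := ⟨_, rfl⟩
  have hf'cont : ContinuousOn f' (Icc a R) :=
    hf' ▸ hf.continuousOn_derivWithin (uniqueDiffOn_Icc haR) le_rfl
  have hfcont : ContinuousOn f (Icc a R) := hf.continuousOn
  have hfder : ∀ r ∈ Ioo a R, HasDerivAt f (f' r) r := fun r hr => by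
    have h := (hf.differentiableOn one_ne_zero r (Ioo_subset_Icc_self hr)).hasDerivWithinAt
    rw [← hf'] at h
    exact h.hasDerivAt (Icc_mem_nhds hr.1 hr.2)
  have hQcont : ContinuousOn Q (Icc a R) := fun r hr =>
    (hQ.hasDerivAt r (hrpos r hr)).continuousAt.continuousWithinAt
  have hPcont : ContinuousOn P (Icc a R) := fun r hr =>
    (hQ.hasDerivAt_deriv r (hrpos r hr)).continuousAt.continuousWithinAt
  have hwcont : ContinuousOn w (Icc a R) := fun r hr =>
    (hQ.hasDerivAt_scalingMode (hrpos r hr)).continuousAt.continuousWithinAt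
  have hw'cont : ContinuousOn (fun r => r ^ 2 * w' r) (Icc a R) := fun r hr =>
    (hQ.hasDerivAt_sq_mul_scalingModeDeriv hm (hrpos r hr)).continuousAt.continuousWithinAt
  have hgcont : ContinuousOn g (Icc a R) := hfcont.sub (continuousOn_const.mul hQcont)
  have hgder : ∀ r ∈ Ioo a R, HasDerivAt g (f' r - t * P r) r := fun r hr =>
    (hfder r hr).sub ((hQ.hasDerivAt r (ha.trans hr.1)).const_mul t)
  have hgc : g c = 0 := by simp only [hg, ht]; field_simp; ring
  have hcong : ∀ u : ℝ → ℝ → ℝ,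
      ∫ r in a..R, u (deriv f r) r = ∫ r in a..R, u (f' r) r := fun u => by
    rw [intervalIntegral.integral_of_le haR.le, intervalIntegral.integral_of_le haR.le,
      integral_Ioc_eq_integral_Ioo, integral_Ioc_eq_integral_Ioo]
    exact setIntegral_congr_fun measurableSet_Ioo fun r hr => by
      simp only [(hfder r hr).deriv]
  rw [hcong fun d r => d * P r * r ^ 2] at horth
  rw [hcong fun d r => d ^ 2 * r ^ 2]
  -- the Picone quotient is continuous across the common zero `c` of `g` and `w`
  set φ : ℝ → ℝ := fun r => r ^ 2 * w' r * (g r ^ 2 / w r) with hφ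
  have hφcont : ContinuousOn φ (Icc a R) := by
    have hnhds : Icc a R ∈ 𝓝 c := Icc_mem_nhds hac hcR
    have hdg : ContinuousOn (dslope g c) (Icc a R) :=
      (continuousOn_dslope hnhds).2 ⟨hgcont, (hgder c hcmem).differentiableAt⟩
    have hwd := hQ.hasDerivAt_scalingMode (ha.trans hac)
    have hdw : ContinuousOn (dslope w c) (Icc a R) :=
      (continuousOn_dslope hnhds).2 ⟨hwcont, hwd.differentiableAt⟩
    have hdw0 : ∀ r ∈ Icc a R, dslope w c r ≠ 0 := fun r hr => by
      by_cases hrc : r = c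
      · rw [hrc, dslope_same, hwd.deriv]
        exact hw'c
      · rw [dslope_of_ne _ hrc, slope_def_field, hwc, sub_zero]
        exact div_ne_zero (hw r hr hrc) (sub_ne_zero.2 hrc)
    have heq : ∀ r, φ r = r ^ 2 * w' r * ((r - c) * dslope g c r ^ 2 / dslope w c r) :=
      fun r => by
        by_cases hrc : r = c
        · simp [hφ, hrc, hgc]
        · have hrc' : r - c ≠ 0 := sub_ne_zero.2 hrc
          simp only [hφ]
          rw [dslope_of_ne _ hrc, dslope_of_ne _ hrc, slope_def_field, slope_def_field, hwc, hgc,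
            sub_zero, sub_zero]
          by_cases hw0 : w r = 0
          · simp [hw0]
          · field_simp
    exact (hw'cont.mul (((continuousOn_id.sub continuousOn_const).mul (hdg.pow 2)).div hdw
      hdw0)).congr fun r _ => heq r
  set Φ : ℝ → ℝ := fun r => φ r + 2 * t * (2 * m + 1) * (f r * (r ^ 2 * P r))
    - t ^ 2 * (r ^ 2 * P r * Q r) with hΦ
  have hΦcont : ContinuousOn Φ (Icc a R) := by
    fun_prop
  set I : ℝ → ℝ := fun r => f' r ^ 2 * r ^ 2 - (2 * m + 1) * (Q r ^ (2 * m) * f r ^ 2 * r ^ 2)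
    + 4 * m * t * (f' r * P r * r ^ 2) with hI
  have hIcont : ContinuousOn I (Icc a R) := by
    fun_prop
  have hder : ∀ r ∈ Ioo a R, r ≠ c → ∃ D, HasDerivAt Φ D r ∧ D ≤ I r := fun r hr hrc => by
    have hr0 : 0 < r := ha.trans hr.1
    have hw0 : w r ≠ 0 := hw r (Ioo_subset_Icc_self hr) hrc
    have h1 := (hQ.hasDerivAt_sq_mul_scalingModeDeriv hm hr0).mul
      (((hgder r hr).pow 2).div (hQ.hasDerivAt_scalingMode hr0) hw0)
    have h2 := ((hfder r hr).mul (hQ.hasDerivAt_sq_mul_deriv hr0)).const_mul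
      (2 * t * (2 * m + 1))
    have h3 := ((hQ.hasDerivAt_sq_mul_deriv hr0).mul (hQ.hasDerivAt r hr0)).const_mul (t ^ 2)
    refine ⟨_, (h1.add h2).sub h3, ?_⟩
    rw [← hwdef, ← hw'def]
    have hsq : 0 ≤ r ^ 2 * ((f' r - t * P r) - g r * w' r / w r) ^ 2 := by positivity
    have hQp : 0 ≤ t ^ 2 * (2 * m) * (r ^ 2 * Q r ^ (2 * m + 2)) := by
      have : Q r ^ (2 * m + 2) = (Q r ^ (m + 1)) ^ 2 := by rw [← pow_mul]; ring_nf
      rw [this]; positivity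
    rw [← sub_nonneg]
    refine LE.le.trans_eq (by exact add_nonneg hsq hQp) ?_
    simp only [hI, hg, Pi.pow_apply, Pi.div_apply]
    field_simp
    ring
  have hstep : ∀ x y, x ≤ y → Icc x y ⊆ Icc a R → c ∉ Ioo x y →
      Φ y - Φ x ≤ ∫ r in x..y, I r := fun x y hxy hsub hcxy => by
    have hsub' : Ioo x y ⊆ Ioo a R := by
      rw [← interior_Icc, ← interior_Icc]; exact interior_mono hsub
    have hD : ∀ r ∈ Ioo x y, HasDerivAt Φ (deriv Φ r) r ∧ deriv Φ r ≤ I r := fun r hr => by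
      obtain ⟨D, hD1, hD2⟩ := hder r (hsub' hr) fun h => hcxy (h ▸ hr)
      rw [hD1.deriv]
      exact ⟨hD1, hD2⟩
    exact intervalIntegral.sub_le_integral_of_hasDeriv_right_of_le hxy (hΦcont.mono hsub)
      (fun r hr => (hD r hr).1.hasDerivWithinAt) (hIcont.mono hsub).integrableOn_Icc
      fun r hr => (hD r hr).2
  have hs1 := hstep a c hac.le (Icc_subset_Icc_right hcR.le) fun h => h.2.false
  have hs2 := hstep c R hcR.le (Icc_subset_Icc_left hac.le) fun h => h.1.false
  have hadd : (∫ r in a..c, I r) + ∫ r in c..R, I r = ∫ r in a..R, I r :=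
    intervalIntegral.integral_add_adjacent_intervals
      ((hIcont.mono (Icc_subset_Icc_right hcR.le)).intervalIntegrable_of_Icc hac.le)
      ((hIcont.mono (Icc_subset_Icc_left hac.le)).intervalIntegrable_of_Icc hcR.le)
  have hintegral : ∫ r in a..R, I r = (∫ r in a..R, f' r ^ 2 * r ^ 2)
      - (2 * m + 1) * ∫ r in a..R, Q r ^ (2 * m) * f r ^ 2 * r ^ 2 := by
    have i1 : IntervalIntegrable (fun r => f' r ^ 2 * r ^ 2) volume a R :=
      ContinuousOn.intervalIntegrable_of_Icc haR.le (by fun_prop)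
    have i2 : IntervalIntegrable (fun r => (2 * m + 1) * (Q r ^ (2 * m) * f r ^ 2 * r ^ 2))
        volume a R := ContinuousOn.intervalIntegrable_of_Icc haR.le (by fun_prop)
    have i3 : IntervalIntegrable (fun r => 4 * m * t * (f' r * P r * r ^ 2))
        volume a R := ContinuousOn.intervalIntegrable_of_Icc haR.le (by fun_prop)
    simp only [hI]
    rw [intervalIntegral.integral_add (i1.sub i2) i3, intervalIntegral.integral_sub i1 i2,
      intervalIntegral.integral_const_mul, intervalIntegral.integral_const_mul, horth]
    ring
  have hΦa : Φ a = 0 := by simp [hΦ, hφ, hg, hfa, hQa]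
  have hwR : w R ≠ 0 := hw R (right_mem_Icc.2 haR.le) hcR.ne'
  have hΦR : Φ R = t ^ 2 * (Q R / w R * (R ^ 2 * (Q R * w' R - P R * w R))) := by
    simp only [hΦ, hφ, hg, hfR]
    field_simp
    ring
  rw [← hΦR, ← hintegral]
  linarith

/-- Nonnegativity of the linearized form between two consecutive zeros of a positive solution. -/
lemma form_nonneg_of_pos (hm : 2 < m) (hQ : IsRadialSolution m Q P) {a b : ℝ} (ha : 0 < a)
    (hab : a < b) (hQa : Q a = 0) (hQb : Q b = 0) (hpos : ∀ r ∈ Ioo a b, 0 < Q r)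
    {f : ℝ → ℝ} (hf : ContDiffOn ℝ 1 f (Icc a b)) (hfa : f a = 0) (hfb : f b = 0)
    (horth : ∫ r in a..b, deriv f r * P r * r ^ 2 = 0) :
    (2 * (m : ℝ) + 1) * ∫ r in a..b, Q r ^ (2 * m) * f r ^ 2 * r ^ 2
      ≤ ∫ r in a..b, (deriv f r) ^ 2 * r ^ 2 := by
  have hE : ∀ r ∈ Ioo a b, 0 ≤ emdenFowlerEnergy m Q P r := fun r hr =>
    (energy_nonneg_of_zero (ha.trans hab) hQb).trans
      (hQ.energy_antitone hm (ha.trans hr.1) (ha.trans hab) hr.2.le)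
  obtain ⟨c, hc, hwc, hw'c, hwl, hwr⟩ := hQ.exists_scalingMode_zero hm ha hab hpos hE
    (hQ.scalingMode_left_pos ha hab hpos hQa) (hQ.scalingMode_right_neg ha hab hpos hQb)
  have h := hQ.picone (by omega) ha hc.1 hc.2 hQa (hpos c hc).ne' hwc hw'c.ne
    (fun r hr hrc => hrc.lt_or_gt.elim (fun h => (hwl r ⟨hr.1, h⟩).ne')
      fun h => (hwr r ⟨h, hr.2⟩).ne) hf hfa hfb horth
  rw [hQb] at h
  simp only [zero_div, zero_mul, mul_zero] at h
  linarith

/-- Nonnegativity of the linearized form between two consecutive zeros. -/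
lemma form_nonneg (hm : 2 < m) (hQ : IsRadialSolution m Q P) {a b : ℝ} (ha : 0 < a)
    (hab : a < b) (hQa : Q a = 0) (hQb : Q b = 0) (hne : ∀ r ∈ Ioo a b, Q r ≠ 0)
    {f : ℝ → ℝ} (hf : ContDiffOn ℝ 1 f (Icc a b)) (hfa : f a = 0) (hfb : f b = 0)
    (horth : ∫ r in a..b, deriv f r * P r * r ^ 2 = 0) :
    (2 * (m : ℝ) + 1) * ∫ r in a..b, Q r ^ (2 * m) * f r ^ 2 * r ^ 2
      ≤ ∫ r in a..b, (deriv f r) ^ 2 * r ^ 2 := by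
  have hcont : ContinuousOn Q (Ioo a b) := fun r hr =>
    (hQ.hasDerivAt r (ha.trans hr.1)).continuousAt.continuousWithinAt
  have hsign : (∀ r ∈ Ioo a b, 0 < Q r) ∨ ∀ r ∈ Ioo a b, Q r < 0 := by
    by_contra! hcon
    obtain ⟨⟨x, hx, hx0⟩, y, hy, hy0⟩ := hcon
    obtain ⟨z, hz, hz0⟩ := isPreconnected_Ioo.intermediate_value hx hy hcont ⟨hx0, hy0⟩
    exact hne z hz hz0
  rcases hsign with hpos | hneg
  · exact hQ.form_nonneg_of_pos hm ha hab hQa hQb hpos hf hfa hfb horth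
  · have h := hQ.neg.form_nonneg_of_pos hm ha hab (by simp [hQa]) (by simp [hQb])
      (fun r hr => neg_pos.2 (hneg r hr)) hf hfa hfb (by
        simpa only [mul_neg, neg_mul, intervalIntegral.integral_neg, neg_eq_zero] using horth)
    simpa only [Even.neg_pow (even_two_mul m)] using h

lemma tendsto_zero_of_tendsto_mul {F : ℝ → ℝ} {K : ℝ}
    (h : Tendsto (fun r => r * F r) atTop (𝓝 K)) : Tendsto F atTop (𝓝 0) := by
  have h' := h.mul tendsto_inv_atTop_zero
  rw [mul_zero] at h'
  refine h'.congr' ?_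
  filter_upwards [eventually_gt_atTop 0] with r hr
  field_simp

lemma energy_nonneg_of_decay (hm : 2 < m) (hQ : IsRadialSolution m Q P) {K : ℝ}
    (hK : Tendsto (fun r => r * Q r) atTop (𝓝 K)) {r : ℝ} (hr : 0 < r) :
    0 ≤ emdenFowlerEnergy m Q P r := by
  have hm2 : (2 : ℝ) < m := by exact_mod_cast hm
  have h1m : 1 / (m : ℝ) < 1 := by rw [div_lt_one (by linarith)]; linarith
  have h2m : 2 / (m : ℝ) < 1 := by rw [div_lt_one (by linarith)]; exact hm2
  set β : ℝ := 1 / (m : ℝ) * (1 - 1 / (m : ℝ)) with hβ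
  have hβ0 : 0 ≤ β := mul_nonneg (by positivity) (by linarith)
  have hlim : Tendsto (fun t => -(β / 2 * (t * Q t * Q t))) atTop (𝓝 0) := by
    have := ((hK.mul (tendsto_zero_of_tendsto_mul hK)).const_mul (β / 2)).neg
    simpa using this
  refine le_of_tendsto hlim ?_
  filter_upwards [eventually_ge_atTop r, eventually_ge_atTop 1] with t htr ht1
  have ht0 : 0 < t := by linarith
  refine le_trans ?_ (hQ.energy_antitone hm hr ht0 htr)
  have hpow : t ^ (2 / (m : ℝ)) ≤ t := by
    simpa using Real.rpow_le_rpow_of_exponent_le ht1 h2m.le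
  have hpow0 : 0 ≤ t ^ (2 / (m : ℝ)) := Real.rpow_nonneg ht0.le _
  have hQp : 0 ≤ Q t ^ (2 * m + 2) := Even.pow_nonneg ⟨m + 1, by ring⟩ _
  have h1 : 0 ≤ t ^ (2 / (m : ℝ)) * (scalingMode m Q P t ^ 2 / 2
      + t ^ 2 * Q t ^ (2 * m + 2) / (2 * m + 2)) := by positivity
  have h2 : t ^ (2 / (m : ℝ)) * (β * Q t ^ 2 / 2) ≤ t * (β * Q t ^ 2 / 2) :=
    mul_le_mul_of_nonneg_right hpow (by positivity)
  unfold emdenFowlerEnergy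
  rw [← hβ]
  nlinarith

lemma tendsto_boundary (hm : 2 < m) {K : ℝ} (hK0 : K ≠ 0)
    (hK : Tendsto (fun r => r * Q r) atTop (𝓝 K))
    (hPK : Tendsto (fun r => r ^ 2 * P r) atTop (𝓝 (-K))) :
    Tendsto (fun r => Q r / scalingMode m Q P r *
        (r ^ 2 * (Q r * scalingModeDeriv m Q P r - P r * scalingMode m Q P r)))
      atTop (𝓝 0) := by
  have hm2 : (2 : ℝ) < m := by exact_mod_cast hm
  have h1m : 1 / (m : ℝ) < 1 := by rw [div_lt_one (by linarith)]; linarith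
  have hQ0 := tendsto_zero_of_tendsto_mul hK
  have hrP : Tendsto (fun r => r * P r) atTop (𝓝 0) :=
    tendsto_zero_of_tendsto_mul (hPK.congr fun r => by ring)
  have hw : Tendsto (scalingMode m Q P) atTop (𝓝 0) := by
    have h := hrP.add (hQ0.div_const (m : ℝ))
    rw [zero_div, add_zero] at h
    exact h
  have hrw : Tendsto (fun r => r * scalingMode m Q P r) atTop (𝓝 (-K + K / m)) :=
    (hPK.add (hK.div_const (m : ℝ))).congr fun r => by unfold scalingMode; ring
  have hne : -K + K / m ≠ 0 := by
    have : -K + K / m = -(K * (1 - 1 / m)) := by ring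
    rw [this, neg_ne_zero]
    exact mul_ne_zero hK0 (by linarith)
  have hQpow : Tendsto (fun r => Q r ^ (2 * m - 1)) atTop (𝓝 0) := by
    simpa [zero_pow (show 2 * m - 1 ≠ 0 by omega)] using hQ0.pow (2 * m - 1)
  have hrw' : Tendsto (fun r => r * scalingModeDeriv m Q P r) atTop (𝓝 0) := by
    have h := (hrP.const_mul (-(1 - 1 / (m : ℝ)))).sub ((hK.pow 2).mul hQpow)
    simp only [mul_zero, sub_zero] at h
    refine h.congr fun r => ?_
    unfold scalingModeDeriv
    rw [show 2 * m + 1 = 2 + (2 * m - 1) by omega, pow_add]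
    ring
  have h := (hK.div hrw hne).mul ((hK.mul hrw').sub (hPK.mul hw))
  simp only [mul_zero, sub_zero] at h
  refine h.congr' ?_
  filter_upwards [eventually_gt_atTop 0] with r hr
  simp only [Pi.div_apply]
  rw [mul_div_mul_left _ _ hr.ne']
  ring

lemma eventually_scalingMode_neg (hm : 2 < m) {K : ℝ} (hK0 : 0 < K)
    (hK : Tendsto (fun r => r * Q r) atTop (𝓝 K))
    (hPK : Tendsto (fun r => r ^ 2 * P r) atTop (𝓝 (-K))) :
    ∀ᶠ r in atTop, scalingMode m Q P r < 0 := by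
  have hm2 : (2 : ℝ) < m := by exact_mod_cast hm
  have hrw : Tendsto (fun r => r * scalingMode m Q P r) atTop (𝓝 (-K + K / m)) :=
    (hPK.add (hK.div_const (m : ℝ))).congr fun r => by unfold scalingMode; ring
  have hlt : -K + K / m < 0 := by
    have : K / m < K := div_lt_self hK0 (by linarith)
    linarith
  filter_upwards [hrw.eventually (gt_mem_nhds hlt), eventually_gt_atTop 0] with r h1 h2
  exact (pos_iff_neg_of_mul_neg h1).1 h2

/-- Nonnegativity of the linearized form on the unbounded nodal domain. -/
lemma form_nonneg_Ioi (hm : 2 < m) (hQ : IsRadialSolution m Q P) {a K : ℝ} (ha : 0 < a)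
    (hQa : Q a = 0) (hne : ∀ r ∈ Ioi a, Q r ≠ 0) (hK0 : 0 < K)
    (hK : Tendsto (fun r => r * Q r) atTop (𝓝 K))
    (hPK : Tendsto (fun r => r ^ 2 * P r) atTop (𝓝 (-K)))
    {f : ℝ → ℝ} (hf : ContDiffOn ℝ 1 f (Ici a)) (hfa : f a = 0) (hfs : HasCompactSupport f)
    (horth : ∫ r in Ioi a, deriv f r * P r * r ^ 2 = 0) :
    (2 * (m : ℝ) + 1) * ∫ r in Ioi a, Q r ^ (2 * m) * f r ^ 2 * r ^ 2
      ≤ ∫ r in Ioi a, (deriv f r) ^ 2 * r ^ 2 := by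
  have hcont : ContinuousOn Q (Ioi a) := fun r hr =>
    (hQ.hasDerivAt r (ha.trans hr)).continuousAt.continuousWithinAt
  have hpos : ∀ r ∈ Ioi a, 0 < Q r := by
    by_contra! hcon
    obtain ⟨x, hx, hx0⟩ := hcon
    obtain ⟨y, hy1, hy2⟩ := ((hK.eventually (lt_mem_nhds hK0)).and (eventually_gt_atTop a)).exists
    have hy0 : 0 < Q y := pos_of_mul_pos_right hy1 (ha.trans hy2).le
    obtain ⟨z, hz, hz0⟩ := isPreconnected_Ioi.intermediate_value hx hy2 hcont ⟨hx0, hy0.le⟩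
    exact hne z hz hz0
  have hE : ∀ r > 0, 0 ≤ emdenFowlerEnergy m Q P r := fun r hr =>
    hQ.energy_nonneg_of_decay hm hK hr
  obtain ⟨R₀, hR₀, haR₀⟩ :=
    ((eventually_scalingMode_neg hm hK0 hK hPK).and (eventually_gt_atTop a)).exists
  obtain ⟨c, hc, hwc, hw'c, hwl, -⟩ := hQ.exists_scalingMode_zero hm ha haR₀
    (fun r hr => hpos r hr.1) (fun r hr => hE r (ha.trans hr.1))
    (hQ.scalingMode_left_pos ha haR₀ (fun r hr => hpos r hr.1) hQa) hR₀
  have hwr : ∀ r, c < r → scalingMode m Q P r < 0 := fun r hr =>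
    hQ.scalingMode_neg_of_nonpos hm (ha.trans hc.1) hr
      (fun s hs => hpos s (hc.1.trans_le hs.1))
      (fun s hs => hE s ((ha.trans hc.1).trans_le hs.1)) hwc.le
  obtain ⟨B, hB⟩ := hfs.isCompact.bddAbove
  have hfB : ∀ r, B < r → f r = 0 := fun r hr =>
    image_eq_zero_of_notMem_tsupport fun h => (hB h).not_gt hr
  have hf'B : ∀ r, B < r → deriv f r = 0 := fun r hr => by
    have : f =ᶠ[𝓝 r] fun _ => (0 : ℝ) := by
      filter_upwards [lt_mem_nhds hr] with s hs using hfB s hs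
    rw [this.deriv_eq, deriv_const]
  have htrunc : ∀ R, a ≤ R → B < R → ∀ u : ℝ → ℝ, (∀ r, B < r → u r = 0) →
      ∫ r in Ioi a, u r = ∫ r in a..R, u r := fun R haR hBR u hu => by
    rw [intervalIntegral.integral_of_le haR]
    exact setIntegral_eq_of_subset_of_forall_sdiff_eq_zero measurableSet_Ioi
      Ioc_subset_Ioi_self fun r hr => hu r (hBR.trans (not_le.1 fun h => hr.2 ⟨hr.1, h⟩))
  have hlim := (tendsto_boundary hm hK0.ne' hK hPK).const_mul ((f c / Q c) ^ 2)
  rw [mul_zero] at hlim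
  rw [← sub_nonneg]
  refine le_of_tendsto hlim ?_
  filter_upwards [eventually_gt_atTop c, eventually_gt_atTop B] with R hcR hBR
  have haR : a ≤ R := (hc.1.trans hcR).le
  rw [htrunc R haR hBR _ fun r hr => by simp [hf'B r hr]] at horth
  rw [htrunc R haR hBR (fun r => (deriv f r) ^ 2 * r ^ 2) fun r hr => by simp [hf'B r hr],
    htrunc R haR hBR (fun r => Q r ^ (2 * m) * f r ^ 2 * r ^ 2) fun r hr => by simp [hfB r hr]]
  exact hQ.picone (by omega) ha hc.1 hcR hQa (hpos c hc.1).ne' hwc hw'c.ne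
    (fun r hr hrc => hrc.lt_or_gt.elim (fun h => (hwl r ⟨hr.1, h⟩).ne') fun h => (hwr r h).ne)
    (hf.mono Icc_subset_Ici_self) hfa (hfB R hBR) horth

/-- The scaling symmetry of the equation. -/
lemma rescale (hm : m ≠ 0) (hQ : IsRadialSolution m Q P) {ρ : ℝ} (hρ : 0 < ρ) :
    IsRadialSolution m (fun r => ρ ^ ((1 : ℝ) / (m : ℝ)) * Q (ρ * r))
      (fun r => ρ ^ ((1 : ℝ) / (m : ℝ)) * (P (ρ * r) * ρ)) where
  hasDerivAt r hr := by
    have hlin : HasDerivAt (fun r => ρ * r) ρ r := by simpa using (hasDerivAt_id r).const_mul ρ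
    exact ((hQ.hasDerivAt _ (mul_pos hρ hr)).comp r hlin).const_mul _
  hasDerivAt_deriv r hr := by
    have hlin : HasDerivAt (fun r => ρ * r) ρ r := by simpa using (hasDerivAt_id r).const_mul ρ
    have hm' : (m : ℝ) ≠ 0 := by exact_mod_cast hm
    have hpow : (ρ ^ ((1 : ℝ) / (m : ℝ))) ^ (2 * m) = ρ ^ 2 := by
      rw [mul_comm 2 m, pow_mul, ← Real.rpow_natCast _ m, ← Real.rpow_mul hρ.le,
        one_div_mul_cancel hm', Real.rpow_one]
    refine ((((hQ.hasDerivAt_deriv _ (mul_pos hρ hr)).comp r hlin).mul_const ρ).const_mul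
      _).congr_deriv ?_
    rw [mul_pow, pow_succ (ρ ^ ((1 : ℝ) / (m : ℝ))), hpow]
    field_simp

end IsRadialSolution

/-- nonnegativity of the linearized quadratic form on each nodal
annulus of $Q_j$, for radial Dirichlet functions orthogonal to $Q_j$ in $\dot H^1$. -/
theorem stmt_8
    (m : ℕ) (hm : 2 < m)
    (Z : ℝ → ℝ) (rs : ℕ → ℝ)
    (hZreg : ContDiffOn ℝ 2 Z (Set.Ioi 0))
    (hZode : ∀ r > (0:ℝ), deriv (deriv Z) r + (2 / r) * deriv Z r + Z r ^ (2 * m + 1) = 0)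
    (hZdecay : ∃ C > (0:ℝ), ∀ r ≥ (1:ℝ), |r * Z r - 1| ≤ C / r ^ 2)
    (hZderiv : Filter.Tendsto (fun r => r ^ 2 * deriv Z r) Filter.atTop (nhds (-1)))
    (hrs_pos : ∀ j, 0 < rs j)
    (hrs_anti : StrictAnti rs)
    (hrs_lim : Filter.Tendsto rs Filter.atTop (nhds 0))
    (hrs_zeros : {r : ℝ | 0 < r ∧ Z r = 0} = Set.range rs)
    (Q : ℕ → ℝ → ℝ)
    (hQ : ∀ j r, Q j r = rs j ^ ((1:ℝ) / (m:ℝ)) * Z (rs j * r))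
    (j : ℕ) :
    (∀ i, i < j → ∀ f : ℝ → ℝ,
      ContDiffOn ℝ 1 f (Set.Icc (rs (j - i) / rs j) (rs (j - (i + 1)) / rs j)) →
      f (rs (j - i) / rs j) = 0 → f (rs (j - (i + 1)) / rs j) = 0 →
      (∫ r in (rs (j - i) / rs j)..(rs (j - (i + 1)) / rs j),
          deriv f r * deriv (Q j) r * r ^ 2) = 0 →
      (2 * (m:ℝ) + 1) * ∫ r in (rs (j - i) / rs j)..(rs (j - (i + 1)) / rs j),
          Q j r ^ (2 * m) * f r ^ 2 * r ^ 2
        ≤ ∫ r in (rs (j - i) / rs j)..(rs (j - (i + 1)) / rs j), (deriv f r) ^ 2 * r ^ 2)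
    ∧
    (∀ f : ℝ → ℝ,
      ContDiffOn ℝ 1 f (Set.Ici (rs 0 / rs j)) →
      f (rs 0 / rs j) = 0 → HasCompactSupport f →
      (∫ r in Set.Ioi (rs 0 / rs j), deriv f r * deriv (Q j) r * r ^ 2) = 0 →
      (2 * (m:ℝ) + 1) * ∫ r in Set.Ioi (rs 0 / rs j), Q j r ^ (2 * m) * f r ^ 2 * r ^ 2
        ≤ ∫ r in Set.Ioi (rs 0 / rs j), (deriv f r) ^ 2 * r ^ 2) := by
  have hm0 : m ≠ 0 := by omega
  have hZ : IsRadialSolution m Z (deriv Z) :=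
    { hasDerivAt := fun r hr =>
        ((hZreg.differentiableOn two_ne_zero).differentiableAt (Ioi_mem_nhds hr)).hasDerivAt
      hasDerivAt_deriv := fun r hr => by
        have hd : ContDiffOn ℝ 1 (deriv Z) (Ioi 0) :=
          ((contDiffOn_succ_iff_deriv_of_isOpen (n := 1) isOpen_Ioi).1 hZreg).2.2
        refine ((hd.differentiableOn one_ne_zero).differentiableAt
          (Ioi_mem_nhds hr)).hasDerivAt.congr_deriv ?_
        linarith [hZode r hr] }
  have hρ := hrs_pos j
  set ρ := rs j with hρdef
  set k : ℝ := ρ ^ ((1 : ℝ) / (m : ℝ)) with hk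
  have hk0 : 0 < k := Real.rpow_pos_of_pos hρ _
  have hQj : Q j = fun r => k * Z (ρ * r) := funext (hQ j)
  have hsol : IsRadialSolution m (Q j) (fun r => k * (deriv Z (ρ * r) * ρ)) := by
    rw [hQj]; exact hZ.rescale hm0 hρ
  have hzero : ∀ i, Q j (rs i / ρ) = 0 := fun i => by
    have : rs i ∈ {r : ℝ | 0 < r ∧ Z r = 0} := hrs_zeros ▸ mem_range_self i
    rw [hQj]
    simp only [mul_div_cancel₀ _ hρ.ne', this.2, mul_zero]
  have hzero' : ∀ r > 0, Q j r = 0 → ∃ i, rs i = ρ * r := fun r hr h => by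
    rw [hQj] at h
    have : ρ * r ∈ {r : ℝ | 0 < r ∧ Z r = 0} :=
      ⟨mul_pos hρ hr, (mul_eq_zero.1 h).resolve_left hk0.ne'⟩
    rwa [hrs_zeros] at this
  have hderiv : ∀ r > 0, deriv (Q j) r = k * (deriv Z (ρ * r) * ρ) := fun r hr =>
    (hsol.hasDerivAt r hr).deriv
  have hpos : ∀ i, 0 < rs i / ρ := fun i => div_pos (hrs_pos i) hρ
  refine ⟨fun i hi f hf hfa hfb horth => ?_, fun f hf hfa hfs horth => ?_⟩
  · have hlt : rs (j - i) / ρ < rs (j - (i + 1)) / ρ :=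
      div_lt_div_of_pos_right (hrs_anti (by omega)) hρ
    refine hsol.form_nonneg hm (hpos _) hlt (hzero _) (hzero _) (fun r hr h => ?_) hf hfa hfb ?_
    · obtain ⟨l, hl⟩ := hzero' r ((hpos _).trans hr.1) h
      have h1 : rs (j - i) < rs l := by rw [hl, mul_comm]; exact (div_lt_iff₀ hρ).1 hr.1
      have h2 : rs l < rs (j - (i + 1)) := by rw [hl, mul_comm]; exact (lt_div_iff₀ hρ).1 hr.2
      have h3 := hrs_anti.lt_iff_gt.1 h1
      have h4 := hrs_anti.lt_iff_gt.1 h2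
      omega
    · rw [← horth]
      refine intervalIntegral.integral_congr fun r hr => ?_
      rw [uIcc_of_le hlt.le] at hr
      simp only [hderiv r ((hpos _).trans_le hr.1)]
  · have hZlim : Tendsto (fun r => r * Z r) atTop (𝓝 1) := by
      obtain ⟨C, -, hC⟩ := hZdecay
      rw [tendsto_iff_norm_sub_tendsto_zero]
      have hlim : Tendsto (fun r : ℝ => C / r ^ 2) atTop (𝓝 0) :=
        tendsto_const_nhds.div_atTop (tendsto_pow_atTop two_ne_zero)
      refine squeeze_zero' (Eventually.of_forall fun r => norm_nonneg _) ?_ hlim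
      filter_upwards [eventually_ge_atTop 1] with r hr using hC r hr
    have hscale : Tendsto (fun r => ρ * r) atTop atTop := tendsto_id.const_mul_atTop hρ
    have hK : Tendsto (fun r => r * Q j r) atTop (𝓝 (k / ρ)) := by
      have h := (hZlim.comp hscale).const_mul (k / ρ)
      rw [mul_one] at h
      refine h.congr fun r => ?_
      simp only [hQj, Function.comp]
      field_simp
    have hPK : Tendsto (fun r => r ^ 2 * (k * (deriv Z (ρ * r) * ρ))) atTop (𝓝 (-(k / ρ))) := by
      have h := (hZderiv.comp hscale).const_mul (k / ρ)
      rw [mul_neg_one] at h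
      refine h.congr fun r => ?_
      simp only [Function.comp]
      field_simp
    refine hsol.form_nonneg_Ioi hm (hpos 0) (hzero 0) (fun r hr h => ?_) (div_pos hk0 hρ) hK hPK
      hf hfa hfs ?_
    · obtain ⟨l, hl⟩ := hzero' r ((hpos 0).trans hr) h
      have h1 : rs 0 < rs l := by rw [hl, mul_comm]; exact (div_lt_iff₀ hρ).1 hr
      exact absurd (hrs_anti.lt_iff_gt.1 h1) (by omega)
    · rw [← horth]
      refine setIntegral_congr_fun measurableSet_Ioi fun r hr => ?_
      simp only [hderiv r ((hpos 0).trans hr)]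
end

section
/- Fix j ∈ ℕ, set γ_{j,i} = r_{j−i}/r_j for i = 0, 1, …, j and γ_{j,j+1} = +∞. Then for every i ∈ {0, …, j}: ∫_{γ_{j,i}}^{γ_{j,i+1}} Q_j'(r)²·r² dr = ∫_{γ_{j,i}}^{γ_{j,i+1}} Q_j(r)^{2m+2}·r² dr (both integrals being finite), and consequently ∫_{γ_{j,i}}^{γ_{j,i+1}} (Q_j'(r)² − (2m+1)·Q_j(r)^{2m+2})·r² dr = −2m·∫_{γ_{j,i}}^{γ_{j,i+1}} Q_j(r)^{2m+2}·r² dr < 0. -/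
open Set Filter MeasureTheory

/-- The flux `r² q q'` of a radial solution of `q'' + (2/r) q' + q^(2m+1) = 0`. -/
theorem hasDerivAt_sq_mul_mul_of_radial_ode {m : ℕ} {q p : ℝ → ℝ} {r : ℝ} (hr : 0 < r)
    (hq : HasDerivAt q (p r) r)
    (hp : HasDerivAt p (-((2 / r) * p r + q r ^ (2 * m + 1))) r) :
    HasDerivAt (fun x => x ^ 2 * (q x * p x)) (p r ^ 2 * r ^ 2 - q r ^ (2 * m + 2) * r ^ 2) r := by
  refine ((hasDerivAt_pow 2 r).mul (hq.mul hp)).congr_deriv ?_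
  have := hr.ne'
  simp only [Pi.mul_apply]
  field_simp
  push_cast
  ring

/-- A radial solution has equal gradient and potential energies on an annulus bounded by two of
its zeros, and the linearized quadratic form is negative there. -/
theorem radial_energy_identity_annulus {m : ℕ} (hm : 0 < m) {q p : ℝ → ℝ} {a b : ℝ}
    (ha : 0 < a) (hab : a < b)
    (hq : ∀ r > 0, HasDerivAt q (p r) r)
    (hp : ∀ r > 0, HasDerivAt p (-((2 / r) * p r + q r ^ (2 * m + 1))) r)
    (hqa : q a = 0) (hqb : q b = 0) (hne : ∀ r ∈ Ioo a b, q r ≠ 0) :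
    IntervalIntegrable (fun r => p r ^ 2 * r ^ 2) volume a b ∧
      IntervalIntegrable (fun r => q r ^ (2 * m + 2) * r ^ 2) volume a b ∧
      (∫ r in a..b, p r ^ 2 * r ^ 2) = (∫ r in a..b, q r ^ (2 * m + 2) * r ^ 2) ∧
      (∫ r in a..b, (p r ^ 2 - (2 * (m : ℝ) + 1) * q r ^ (2 * m + 2)) * r ^ 2)
        = -(2 * (m : ℝ)) * (∫ r in a..b, q r ^ (2 * m + 2) * r ^ 2) ∧
      (∫ r in a..b, (p r ^ 2 - (2 * (m : ℝ) + 1) * q r ^ (2 * m + 2)) * r ^ 2) < 0 := by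
  have hpos : ∀ r ∈ uIcc a b, 0 < r := fun r hr =>
    ha.trans_le (by rw [uIcc_of_le hab.le] at hr; exact hr.1)
  have hqc : ContinuousOn q (uIcc a b) := fun r hr =>
    (hq r (hpos r hr)).continuousAt.continuousWithinAt
  have hpc : ContinuousOn p (uIcc a b) := fun r hr =>
    (hp r (hpos r hr)).continuousAt.continuousWithinAt
  have hP : IntervalIntegrable (fun r => p r ^ 2 * r ^ 2) volume a b :=
    ContinuousOn.intervalIntegrable (by fun_prop)
  have hQ : IntervalIntegrable (fun r => q r ^ (2 * m + 2) * r ^ 2) volume a b :=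
    ContinuousOn.intervalIntegrable (by fun_prop)
  have hE : (∫ r in a..b, p r ^ 2 * r ^ 2) = ∫ r in a..b, q r ^ (2 * m + 2) * r ^ 2 := by
    have h := intervalIntegral.integral_eq_sub_of_hasDerivAt
      (fun r hr => hasDerivAt_sq_mul_mul_of_radial_ode (hpos r hr) (hq r (hpos r hr))
        (hp r (hpos r hr))) (hP.sub hQ)
    rw [intervalIntegral.integral_sub hP hQ, hqa, hqb] at h
    linarith
  have hL : (∫ r in a..b, (p r ^ 2 - (2 * (m : ℝ) + 1) * q r ^ (2 * m + 2)) * r ^ 2)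
      = -(2 * (m : ℝ)) * (∫ r in a..b, q r ^ (2 * m + 2) * r ^ 2) := by
    have : ∀ r, (p r ^ 2 - (2 * (m : ℝ) + 1) * q r ^ (2 * m + 2)) * r ^ 2
        = p r ^ 2 * r ^ 2 - (2 * (m : ℝ) + 1) * (q r ^ (2 * m + 2) * r ^ 2) := fun r => by ring
    simp only [this]
    rw [intervalIntegral.integral_sub hP (hQ.const_mul _), intervalIntegral.integral_const_mul, hE]
    ring
  refine ⟨hP, hQ, hE, hL, ?_⟩
  have hI : 0 < ∫ r in a..b, q r ^ (2 * m + 2) * r ^ 2 := by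
    refine intervalIntegral.intervalIntegral_pos_of_pos_on hQ (fun r hr => ?_) hab
    have h2 : Even (2 * m + 2) := ⟨m + 1, by ring⟩
    exact mul_pos (h2.pow_pos (hne r hr)) (pow_pos (ha.trans hr.1) 2)
  have hm' : (0 : ℝ) < m := by exact_mod_cast hm
  rw [hL]
  nlinarith [mul_pos hm' hI]

/-- The analogue of `radial_energy_identity_annulus` on the exterior of the largest zero, for a
solution with `q = O(1/r)` and `q' = O(1/r²)` at infinity. -/
theorem radial_energy_identity_exterior {m : ℕ} (hm : 0 < m) {q p : ℝ → ℝ} {a A B : ℝ}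
    (ha : 0 < a)
    (hq : ∀ r > 0, HasDerivAt q (p r) r)
    (hp : ∀ r > 0, HasDerivAt p (-((2 / r) * p r + q r ^ (2 * m + 1))) r)
    (hqa : q a = 0) (hne : ∀ r ∈ Ioi a, q r ≠ 0)
    (hA : Tendsto (fun r => r * q r) atTop (nhds A))
    (hB : Tendsto (fun r => r ^ 2 * p r) atTop (nhds B)) :
    IntegrableOn (fun r => p r ^ 2 * r ^ 2) (Ioi a) ∧
      IntegrableOn (fun r => q r ^ (2 * m + 2) * r ^ 2) (Ioi a) ∧
      (∫ r in Ioi a, p r ^ 2 * r ^ 2) = (∫ r in Ioi a, q r ^ (2 * m + 2) * r ^ 2) ∧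
      (∫ r in Ioi a, (p r ^ 2 - (2 * (m : ℝ) + 1) * q r ^ (2 * m + 2)) * r ^ 2)
        = -(2 * (m : ℝ)) * (∫ r in Ioi a, q r ^ (2 * m + 2) * r ^ 2) ∧
      (∫ r in Ioi a, (p r ^ 2 - (2 * (m : ℝ) + 1) * q r ^ (2 * m + 2)) * r ^ 2) < 0 := by
  have hpos : ∀ r ∈ Ici a, 0 < r := fun r hr => ha.trans_le hr
  have hqc : ContinuousOn q (Ici a) := fun r hr =>
    (hq r (hpos r hr)).continuousAt.continuousWithinAt
  have hpc : ContinuousOn p (Ici a) := fun r hr =>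
    (hp r (hpos r hr)).continuousAt.continuousWithinAt
  have hint : ∀ (f g : ℝ → ℝ) (L : ℝ), ContinuousOn f (Ici a) → Tendsto g atTop (nhds L) →
      (∀ r > 0, f r = g r * r ^ (-2 : ℝ)) → IntegrableOn f (Ioi a) := by
    intro f g L hf hg hfg
    have hO : f =O[atTop] fun r : ℝ => r ^ (-2 : ℝ) := by
      have h := (hg.isBigO_one ℝ).mul
        (Asymptotics.isBigO_refl (fun r : ℝ => r ^ (-2 : ℝ)) atTop)
      simp only [one_mul] at h
      refine h.congr' ?_ EventuallyEq.rfl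
      filter_upwards [eventually_gt_atTop 0] with r hr
      exact (hfg r hr).symm
    refine ((hf.locallyIntegrableOn measurableSet_Ici).integrableOn_of_isBigO_atTop hO
      ⟨Ioi 1, Ioi_mem_atTop 1, ?_⟩).mono_set Ioi_subset_Ici_self
    exact integrableOn_Ioi_rpow_of_lt (by norm_num) one_pos
  have hinv : Tendsto (fun r : ℝ => r⁻¹) atTop (nhds 0) := tendsto_inv_atTop_zero
  have hrpow : ∀ r : ℝ, 0 < r → r ^ (-2 : ℝ) = (r ^ 2)⁻¹ := fun r hr => by
    rw [Real.rpow_neg hr.le]; norm_cast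
  have hP : IntegrableOn (fun r => p r ^ 2 * r ^ 2) (Ioi a) := by
    refine hint _ _ _ (by fun_prop) (hB.pow 2) fun r hr => ?_
    rw [hrpow r hr]
    field_simp
  have hQ : IntegrableOn (fun r => q r ^ (2 * m + 2) * r ^ 2) (Ioi a) := by
    refine hint _ _ _ (by fun_prop) ((hA.pow (2 * m + 2)).mul (hinv.pow (2 * m - 2)))
      fun r hr => ?_
    obtain ⟨k, rfl⟩ : ∃ k, m = k + 1 := ⟨m - 1, by omega⟩
    have h1 : 2 * (k + 1) - 2 = 2 * k := by omega
    rw [hrpow r hr, h1, inv_pow]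
    field_simp
    ring
  have hE : (∫ r in Ioi a, p r ^ 2 * r ^ 2) = ∫ r in Ioi a, q r ^ (2 * m + 2) * r ^ 2 := by
    have hlim : Tendsto (fun r => r ^ 2 * (q r * p r)) atTop (nhds 0) := by
      have h := (hA.mul hB).mul hinv
      rw [mul_zero] at h
      refine h.congr' ?_
      filter_upwards [eventually_gt_atTop 0] with r hr
      field_simp
    have h := integral_Ioi_of_hasDerivAt_of_tendsto' (a := a)
      (fun r hr => hasDerivAt_sq_mul_mul_of_radial_ode (hpos r hr) (hq r (hpos r hr))
        (hp r (hpos r hr))) (hP.sub hQ) hlim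
    rw [integral_sub hP hQ, hqa] at h
    linarith
  have hL : (∫ r in Ioi a, (p r ^ 2 - (2 * (m : ℝ) + 1) * q r ^ (2 * m + 2)) * r ^ 2)
      = -(2 * (m : ℝ)) * (∫ r in Ioi a, q r ^ (2 * m + 2) * r ^ 2) := by
    have : ∀ r, (p r ^ 2 - (2 * (m : ℝ) + 1) * q r ^ (2 * m + 2)) * r ^ 2
        = p r ^ 2 * r ^ 2 - (2 * (m : ℝ) + 1) * (q r ^ (2 * m + 2) * r ^ 2) := fun r => by ring
    simp only [this]
    rw [integral_sub hP (hQ.const_mul _), integral_const_mul, hE]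
    ring
  refine ⟨hP, hQ, hE, hL, ?_⟩
  have h2 : Even (2 * m + 2) := ⟨m + 1, by ring⟩
  have hI : 0 < ∫ r in Ioi a, q r ^ (2 * m + 2) * r ^ 2 := by
    rw [setIntegral_pos_iff_support_of_nonneg_ae
      (Eventually.of_forall fun r => mul_nonneg (h2.pow_nonneg _) (sq_nonneg r)) hQ]
    have hsub : Ioi a ⊆ Function.support (fun r => q r ^ (2 * m + 2) * r ^ 2) ∩ Ioi a :=
      fun r hr => ⟨(mul_pos (h2.pow_pos (hne r hr)) (pow_pos (ha.trans hr) 2)).ne', hr⟩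
    exact lt_of_lt_of_le (by simp) (measure_mono hsub)
  have hm' : (0 : ℝ) < m := by exact_mod_cast hm
  rw [hL]
  nlinarith [mul_pos hm' hI]

/-- on each nodal annulus of $Q_j$ one has
$∫ Q_j'^2 r^2 = ∫ Q_j^{2m+2} r^2$, whence the linearized quadratic form is
strictly negative on the restriction of $Q_j$ there. $γ_{j,i} = r_{j-i}/r_j$,
$γ_{j,j+1} = ∞$. -/
theorem stmt_9
    (m : ℕ) (hm : 2 < m)
    (Z : ℝ → ℝ) (rs : ℕ → ℝ)
    (hZreg : ContDiffOn ℝ 2 Z (Set.Ioi 0))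
    (hZode : ∀ r > (0:ℝ), deriv (deriv Z) r + (2 / r) * deriv Z r + Z r ^ (2 * m + 1) = 0)
    (hZdecay : ∃ C > (0:ℝ), ∀ r ≥ (1:ℝ), |r * Z r - 1| ≤ C / r ^ 2)
    (hZderiv : Filter.Tendsto (fun r => r ^ 2 * deriv Z r) Filter.atTop (nhds (-1)))
    (hrs_pos : ∀ j, 0 < rs j)
    (hrs_anti : StrictAnti rs)
    (hrs_lim : Filter.Tendsto rs Filter.atTop (nhds 0))
    (hrs_zeros : {r : ℝ | 0 < r ∧ Z r = 0} = Set.range rs)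
    (Q : ℕ → ℝ → ℝ)
    (hQ : ∀ j r, Q j r = rs j ^ ((1:ℝ) / (m:ℝ)) * Z (rs j * r))
    (j : ℕ) :
    (∀ i, i < j →
      IntervalIntegrable (fun r => (deriv (Q j) r) ^ 2 * r ^ 2) MeasureTheory.volume
        (rs (j - i) / rs j) (rs (j - (i + 1)) / rs j) ∧
      IntervalIntegrable (fun r => Q j r ^ (2 * m + 2) * r ^ 2) MeasureTheory.volume
        (rs (j - i) / rs j) (rs (j - (i + 1)) / rs j) ∧
      (∫ r in (rs (j - i) / rs j)..(rs (j - (i + 1)) / rs j), (deriv (Q j) r) ^ 2 * r ^ 2)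
        = (∫ r in (rs (j - i) / rs j)..(rs (j - (i + 1)) / rs j), Q j r ^ (2 * m + 2) * r ^ 2) ∧
      (∫ r in (rs (j - i) / rs j)..(rs (j - (i + 1)) / rs j),
          ((deriv (Q j) r) ^ 2 - (2 * (m:ℝ) + 1) * Q j r ^ (2 * m + 2)) * r ^ 2)
        = -(2 * (m:ℝ)) * (∫ r in (rs (j - i) / rs j)..(rs (j - (i + 1)) / rs j),
            Q j r ^ (2 * m + 2) * r ^ 2) ∧
      (∫ r in (rs (j - i) / rs j)..(rs (j - (i + 1)) / rs j),
          ((deriv (Q j) r) ^ 2 - (2 * (m:ℝ) + 1) * Q j r ^ (2 * m + 2)) * r ^ 2) < 0)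
    ∧
    (MeasureTheory.IntegrableOn (fun r => (deriv (Q j) r) ^ 2 * r ^ 2) (Set.Ioi (rs 0 / rs j)) ∧
     MeasureTheory.IntegrableOn (fun r => Q j r ^ (2 * m + 2) * r ^ 2) (Set.Ioi (rs 0 / rs j)) ∧
     (∫ r in Set.Ioi (rs 0 / rs j), (deriv (Q j) r) ^ 2 * r ^ 2)
        = (∫ r in Set.Ioi (rs 0 / rs j), Q j r ^ (2 * m + 2) * r ^ 2) ∧
     (∫ r in Set.Ioi (rs 0 / rs j),
          ((deriv (Q j) r) ^ 2 - (2 * (m:ℝ) + 1) * Q j r ^ (2 * m + 2)) * r ^ 2)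
        = -(2 * (m:ℝ)) * (∫ r in Set.Ioi (rs 0 / rs j), Q j r ^ (2 * m + 2) * r ^ 2) ∧
     (∫ r in Set.Ioi (rs 0 / rs j),
          ((deriv (Q j) r) ^ 2 - (2 * (m:ℝ) + 1) * Q j r ^ (2 * m + 2)) * r ^ 2) < 0) := by
  have hm0 : 0 < m := by omega
  have hs := hrs_pos j
  set s := rs j with hs_def
  set c := s ^ ((1 : ℝ) / (m : ℝ)) with hc_def
  have hc : c ^ (2 * m) = s ^ 2 := by
    have h : c ^ m = s := by
      rw [hc_def, one_div, Real.rpow_inv_natCast_pow hs.le hm0.ne']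
    rw [mul_comm, pow_mul, h]
  have hc0 : 0 < c := Real.rpow_pos_of_pos hs _
  have hQj : Q j = fun r => c * Z (s * r) := funext (hQ j)
  have hZ : ∀ r > 0, HasDerivAt Z (deriv Z r) r := fun r hr =>
    ((hZreg.contDiffAt (Ioi_mem_nhds hr)).differentiableAt (by norm_num)).hasDerivAt
  have hZ' : ∀ r > 0, HasDerivAt (deriv Z) (-((2 / r) * deriv Z r + Z r ^ (2 * m + 1))) r := by
    intro r hr
    have hd : ContDiffOn ℝ 1 (deriv Z) (Ioi 0) := hZreg.deriv_of_isOpen isOpen_Ioi (by norm_num)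
    refine ((hd.contDiffAt (Ioi_mem_nhds hr)).differentiableAt
      (by norm_num)).hasDerivAt.congr_deriv ?_
    linarith [hZode r hr]
  have hscale : ∀ r : ℝ, HasDerivAt (fun x => s * x) s r := fun r => by
    simpa using (hasDerivAt_id r).const_mul s
  have hq : ∀ r > 0, HasDerivAt (Q j) (c * s * deriv Z (s * r)) r := by
    intro r hr
    rw [hQj]
    refine (((hZ (s * r) (mul_pos hs hr)).comp r (hscale r)).const_mul c).congr_deriv ?_
    ring
  have hdq : ∀ r > 0, deriv (Q j) r = c * s * deriv Z (s * r) := fun r hr => (hq r hr).deriv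
  have hq1 : ∀ r > 0, HasDerivAt (Q j) (deriv (Q j) r) r := fun r hr => by
    rw [hdq r hr]; exact hq r hr
  have hp : ∀ r > 0, HasDerivAt (deriv (Q j))
      (-((2 / r) * deriv (Q j) r + Q j r ^ (2 * m + 1))) r := by
    intro r hr
    refine HasDerivAt.congr_of_eventuallyEq (f := fun x => c * s * deriv Z (s * x)) ?_
      (by filter_upwards [Ioi_mem_nhds hr] with x hx using hdq x hx)
    refine (((hZ' (s * r) (mul_pos hs hr)).comp r (hscale r)).const_mul (c * s)).congr_deriv ?_
    rw [hdq r hr, hQj, mul_pow, pow_succ c, hc]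
    field_simp
  have hzero : ∀ r > 0, Q j r = 0 ↔ ∃ k, rs k = s * r := by
    intro r hr
    have h : s * r ∈ {r : ℝ | 0 < r ∧ Z r = 0} ↔ s * r ∈ range rs := by rw [hrs_zeros]
    rw [hQj]
    simpa [hc0.ne', mul_pos hs hr] using h
  have hnode : ∀ k, Q j (rs k / s) = 0 := fun k =>
    (hzero _ (div_pos (hrs_pos k) hs)).2 ⟨k, by field_simp⟩
  refine ⟨fun i hi => ?_, ?_⟩
  · have hlt : rs (j - i) < rs (j - (i + 1)) := hrs_anti (by omega)
    refine radial_energy_identity_annulus hm0 (div_pos (hrs_pos _) hs)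
      (div_lt_div_of_pos_right hlt hs) hq1 hp (hnode _) (hnode _) fun r hr h0 => ?_
    obtain ⟨k, hk⟩ := (hzero r ((div_pos (hrs_pos _) hs).trans hr.1)).1 h0
    have h1 : rs (j - i) < rs k := by rw [hk, mul_comm]; exact (div_lt_iff₀ hs).1 hr.1
    have h2 : rs k < rs (j - (i + 1)) := by rw [hk, mul_comm]; exact (lt_div_iff₀ hs).1 hr.2
    have h3 := hrs_anti.lt_iff_gt.1 h1
    have h4 := hrs_anti.lt_iff_gt.1 h2
    omega
  · have hst : Tendsto (fun r => s * r) atTop atTop := tendsto_id.const_mul_atTop hs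
    have hZlim : Tendsto (fun r => r * Z r) atTop (nhds 1) := by
      obtain ⟨C, -, hC⟩ := hZdecay
      rw [tendsto_iff_norm_sub_tendsto_zero]
      refine squeeze_zero' (Eventually.of_forall fun _ => norm_nonneg _)
        (by filter_upwards [eventually_ge_atTop 1] with r hr using hC r hr)
        (tendsto_const_nhds.div_atTop (tendsto_pow_atTop two_ne_zero))
    refine radial_energy_identity_exterior (A := c / s * 1) (B := c / s * -1) hm0
      (div_pos (hrs_pos _) hs) hq1 hp (hnode 0) (fun r hr h0 => ?_) ?_ ?_
    · obtain ⟨k, hk⟩ := (hzero r ((div_pos (hrs_pos _) hs).trans hr)).1 h0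
      have h1 : rs 0 < rs k := by rw [hk, mul_comm]; exact (div_lt_iff₀ hs).1 hr
      exact absurd (hrs_anti.lt_iff_gt.1 h1) (Nat.not_lt_zero k)
    · refine ((hZlim.comp hst).const_mul (c / s)).congr fun r => ?_
      simp only [Function.comp_apply, hQj]
      field_simp
    · refine ((hZderiv.comp hst).const_mul (c / s)).congr' ?_
      filter_upwards [eventually_gt_atTop 0] with r hr
      simp only [Function.comp_apply, hdq r hr]
      field_simp
end

section
/- Fix j ∈ ℕ and define ΛQ_j(r) = (1/m)·Q_j(r) + r·Q_j'(r). Let μ < 0 and let ψ : [1,∞) → ℝ be a nonzero twice continuously differentiable function with ψ(1) = 0, ∫₁^∞ ψ(r)² dr < ∞, and ψ''(r) + (2m+1)·Q_j(r)^{2m}·ψ(r) + μ·ψ(r) = 0 on (1,∞). Then the number of zeros of ψ in (1,∞) is at most the number of zeros of ΛQ_j in (1,∞) minus one (both zero sets being finite). -/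
open Set Filter MeasureTheory

/-- `y` solves `y'' + P y = 0` on `[1, ∞)` with derivative `y'`. -/
structure IsSolution (P y y' : ℝ → ℝ) : Prop where
  deriv_within : ∀ r, 1 ≤ r → HasDerivWithinAt y (y' r) (Ici 1) r
  continuousOn_deriv : ContinuousOn y' (Ici 1)
  deriv_deriv : ∀ r, 1 < r → HasDerivAt y' (-(P r) * y r) r

namespace IsSolution

variable {P y y' : ℝ → ℝ}

lemma neg (h : IsSolution P y y') : IsSolution P (fun r => -y r) (fun r => -y' r) where
  deriv_within r hr := (h.deriv_within r hr).fun_neg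
  continuousOn_deriv := h.continuousOn_deriv.neg
  deriv_deriv r hr := by
    refine HasDerivAt.congr_deriv ((h.deriv_deriv r hr).fun_neg) ?_
    ring

lemma continuousOn (h : IsSolution P y y') : ContinuousOn y (Ici 1) :=
  fun r hr => (h.deriv_within r hr).continuousWithinAt

lemma hasDerivAt (h : IsSolution P y y') {r : ℝ} (hr : 1 < r) : HasDerivAt y (y' r) r :=
  (h.deriv_within r hr.le).hasDerivAt (Ici_mem_nhds hr)

/-- A solution vanishing to second order at a point vanishes identically. -/
lemma eq_zero (h : IsSolution P y y') (hP : ContinuousOn P (Ici 1)) {c : ℝ} (hc : 1 ≤ c)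
    (hy : y c = 0) (hy' : y' c = 0) {r : ℝ} (hr : 1 ≤ r) : y r = 0 := by
  set R := max c r + 1 with hR
  have hcR : c ≤ R := by have := le_max_left c r; linarith
  have hrR : r ≤ R := by have := le_max_right c r; linarith
  have hsub : Icc 1 R ⊆ Ici (1 : ℝ) := fun x hx => hx.1
  obtain ⟨M, hM⟩ := isCompact_Icc.exists_bound_of_continuousOn (hP.mono hsub)
  have hcont : ContinuousOn (fun t => y t ^ 2 + y' t ^ 2) (Icc 1 R) :=
    ((h.continuousOn.pow 2).add (h.continuousOn_deriv.pow 2)).mono hsub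
  have hder : ∀ t ∈ Ioo 1 R, HasDerivAt (fun t => y t ^ 2 + y' t ^ 2)
      (2 * (y t * y' t) * (1 - P t)) t := by
    intro t ht
    refine HasDerivAt.congr_deriv
      (((h.hasDerivAt ht.1).pow 2).add ((h.deriv_deriv t ht.1).pow 2)) ?_
    push_cast
    ring
  have hbound : ∀ t ∈ Ioo 1 R,
      |2 * (y t * y' t) * (1 - P t)| ≤ (1 + M) * (y t ^ 2 + y' t ^ 2) := by
    intro t ht
    have h1 : |1 - P t| ≤ 1 + M := by
      have := hM t ⟨ht.1.le, ht.2.le⟩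
      rw [Real.norm_eq_abs, abs_le] at this
      rw [abs_le]
      constructor <;> linarith [this.1, this.2]
    have h2 : |2 * (y t * y' t)| ≤ y t ^ 2 + y' t ^ 2 := by
      rw [abs_le]
      constructor <;> nlinarith [sq_nonneg (y t + y' t), sq_nonneg (y t - y' t)]
    rw [abs_mul, mul_comm]
    exact mul_le_mul h1 h2 (abs_nonneg _) ((abs_nonneg _).trans h1)
  have hexp : ∀ (K t : ℝ), HasDerivAt (fun t => Real.exp (K * t)) (Real.exp (K * t) * K) t := by
    intro K t
    simpa using ((hasDerivAt_id t).const_mul K).exp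
  have hprod : ∀ K, ∀ t ∈ Ioo 1 R, HasDerivAt
      (fun t => Real.exp (K * t) * (y t ^ 2 + y' t ^ 2))
      (Real.exp (K * t) * (K * (y t ^ 2 + y' t ^ 2) + 2 * (y t * y' t) * (1 - P t))) t := by
    intro K t ht
    refine HasDerivAt.congr_deriv ((hexp K t).mul (hder t ht)) ?_
    ring
  have hcontK : ∀ K, ContinuousOn (fun t => Real.exp (K * t) * (y t ^ 2 + y' t ^ 2)) (Icc 1 R) :=
    fun K => (Continuous.continuousOn (by fun_prop)).mul hcont
  have hmono : MonotoneOn (fun t => Real.exp ((1 + M) * t) * (y t ^ 2 + y' t ^ 2)) (Icc 1 R) := by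
    refine monotoneOn_of_hasDerivWithinAt_nonneg (convex_Icc 1 R) (hcontK _)
      (fun t ht => (hprod _ t (by rwa [interior_Icc] at ht)).hasDerivWithinAt) (fun t ht => ?_)
    rw [interior_Icc] at ht
    have := (abs_le.1 (hbound t ht)).1
    exact mul_nonneg (Real.exp_pos _).le (by linarith)
  have hanti : AntitoneOn (fun t => Real.exp (-(1 + M) * t) * (y t ^ 2 + y' t ^ 2)) (Icc 1 R) := by
    refine antitoneOn_of_hasDerivWithinAt_nonpos (convex_Icc 1 R) (hcontK _)
      (fun t ht => (hprod _ t (by rwa [interior_Icc] at ht)).hasDerivWithinAt) (fun t ht => ?_)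
    rw [interior_Icc] at ht
    have := (abs_le.1 (hbound t ht)).2
    exact mul_nonpos_of_nonneg_of_nonpos (Real.exp_pos _).le (by linarith)
  have hle : y r ^ 2 + y' r ^ 2 ≤ 0 := by
    rcases le_total r c with hrc | hcr
    · have := hmono ⟨hr, hrR⟩ ⟨hc, hcR⟩ hrc
      simp only [hy, hy'] at this
      by_contra! hpos
      have := mul_pos (Real.exp_pos ((1 + M) * r)) hpos
      linarith
    · have := hanti ⟨hc, hcR⟩ ⟨hr, hrR⟩ hcr
      simp only [hy, hy'] at this
      by_contra! hpos
      have := mul_pos (Real.exp_pos (-(1 + M) * r)) hpos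
      linarith
  nlinarith [sq_nonneg (y r), sq_nonneg (y' r)]

/-- A solution with a nonzero limit at infinity has finitely many zeros. -/
lemma finite_zeros (h : IsSolution P y y') (hP : ContinuousOn P (Ici 1)) {ℓ : ℝ} (hℓ : ℓ ≠ 0)
    (hlim : Tendsto y atTop (nhds ℓ)) : {r | 1 < r ∧ y r = 0}.Finite := by
  obtain ⟨R, hR⟩ := eventually_atTop.1 (hlim.eventually_ne hℓ)
  by_contra hinf
  have hsub : {r | 1 < r ∧ y r = 0} ⊆ Icc 1 R := fun r hr =>
    ⟨hr.1.le, le_of_not_gt fun hlt => hR r hlt.le hr.2⟩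
  obtain ⟨c, hc, hacc⟩ := Set.Infinite.exists_accPt_of_subset_isCompact hinf isCompact_Icc hsub
  have hfreq := accPt_iff_frequently_nhdsNE.1 hacc
  have hfreq' : ∃ᶠ r in nhdsWithin c (Ici 1 \ {c}), y r = 0 := by
    rw [Filter.Frequently, sdiff_eq, inter_comm, nhdsWithin_inter', eventually_inf_principal]
    intro hev
    apply hfreq
    filter_upwards [hev] with r hr hr'
    exact hr hr'.1.le hr'.2
  have hd := h.deriv_within c hc.1
  have hy' : y' c = 0 := by
    by_contra hne
    exact hfreq' (hd.eventually_ne hne)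
  have hy : y c = 0 := by
    by_contra hne
    have := (hd.continuousWithinAt.mono (sdiff_subset (t := {c}))).eventually_ne hne
    exact hfreq' this
  have h1 := hR (max R 1) (le_max_left _ _)
  exact h1 (h.eq_zero hP hc.1 hy hy' (le_max_right _ _))

/-- A nontrivial solution is nonzero somewhere in every interval. -/
lemma exists_ne_zero (h : IsSolution P y y') (hP : ContinuousOn P (Ici 1))
    (hne : ∃ r ≥ (1 : ℝ), y r ≠ 0) {a b : ℝ} (ha : 1 ≤ a) (hab : a < b) :
    ∃ c ∈ Ioo a b, y c ≠ 0 := by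
  by_contra! hzero
  obtain ⟨r, hr, hyr⟩ := hne
  obtain ⟨c, hc⟩ := exists_between hab
  have hev : y =ᶠ[nhds c] fun _ => 0 := by
    filter_upwards [Ioo_mem_nhds hc.1 hc.2] with t ht using hzero t ht
  have hc1 : 1 < c := ha.trans_lt hc.1
  have hd : y' c = 0 :=
    (h.hasDerivAt hc1).unique ((hasDerivAt_const c (0 : ℝ)).congr_of_eventuallyEq hev)
  exact hyr (h.eq_zero hP hc1.le (hzero c hc) hd hr)

lemma deriv_nonneg_of_pos_right (h : IsSolution P y y') {a b : ℝ} (ha : 1 ≤ a) (hab : a < b)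
    (hya : y a = 0) (hpos : ∀ r ∈ Ioo a b, 0 < y r) : 0 ≤ y' a := by
  have hd : HasDerivWithinAt y (y' a) (Ioi a) a :=
    (h.deriv_within a ha).mono fun r hr => ha.trans (le_of_lt hr)
  rw [hasDerivWithinAt_iff_tendsto_slope' self_notMem_Ioi] at hd
  refine ge_of_tendsto hd ?_
  filter_upwards [Ioo_mem_nhdsGT hab] with r hr
  rw [slope_def_field, hya, sub_zero]
  exact div_nonneg (hpos r hr).le (sub_nonneg.2 hr.1.le)

lemma deriv_nonpos_of_pos_left (h : IsSolution P y y') {a b : ℝ} (ha : 1 ≤ a) (hab : a < b)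
    (hyb : y b = 0) (hpos : ∀ r ∈ Ioo a b, 0 < y r) : y' b ≤ 0 := by
  have hd : HasDerivWithinAt y (y' b) (Iio b) b :=
    (h.hasDerivAt (ha.trans_lt hab)).hasDerivWithinAt
  rw [hasDerivWithinAt_iff_tendsto_slope' self_notMem_Iio] at hd
  refine le_of_tendsto hd ?_
  filter_upwards [Ioo_mem_nhdsLT hab] with r hr
  rw [slope_def_field, hyb, sub_zero]
  exact div_nonpos_of_nonneg_of_nonpos (hpos r hr).le (sub_nonpos.2 hr.2.le)

end IsSolution

lemma pos_or_neg_of_ne_zero {s : Set ℝ} (hs : IsPreconnected s) {f : ℝ → ℝ}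
    (hf : ContinuousOn f s) (hne : ∀ r ∈ s, f r ≠ 0) :
    (∀ r ∈ s, 0 < f r) ∨ (∀ r ∈ s, 0 < -f r) := by
  by_contra! hcon
  obtain ⟨⟨p, hp, hfp⟩, q, hq, hfq⟩ := hcon
  obtain ⟨t, ht, hft⟩ := hs.intermediate_value hp hq hf ⟨hfp, by linarith⟩
  exact hne t ht hft

lemma exists_last_zero {f : ℝ → ℝ} {a c : ℝ} (hf : ContinuousOn f (Icc a c)) (hac : a ≤ c)
    (ha : f a = 0) (hc : f c ≠ 0) :
    ∃ p, a ≤ p ∧ p < c ∧ f p = 0 ∧ ∀ r ∈ Ioc p c, f r ≠ 0 := by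
  have hK : IsCompact (Icc a c ∩ f ⁻¹' {0}) := isCompact_Icc.of_isClosed_subset
    (hf.preimage_isClosed_of_isClosed isClosed_Icc isClosed_singleton) inter_subset_left
  obtain ⟨p, ⟨hp, hfp⟩, hmax⟩ := hK.exists_isGreatest ⟨a, left_mem_Icc.2 hac, ha⟩
  refine ⟨p, hp.1, hp.2.lt_of_ne ?_, hfp, fun r hr hfr => ?_⟩
  · rintro rfl
    exact hc hfp
  · exact hr.1.not_ge (hmax ⟨⟨hp.1.trans hr.1.le, hr.2⟩, hfr⟩)

lemma exists_first_zero {f : ℝ → ℝ} {c b : ℝ} (hf : ContinuousOn f (Icc c b)) (hcb : c ≤ b)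
    (hb : f b = 0) (hc : f c ≠ 0) :
    ∃ p, c < p ∧ p ≤ b ∧ f p = 0 ∧ ∀ r ∈ Ico c p, f r ≠ 0 := by
  have hK : IsCompact (Icc c b ∩ f ⁻¹' {0}) := isCompact_Icc.of_isClosed_subset
    (hf.preimage_isClosed_of_isClosed isClosed_Icc isClosed_singleton) inter_subset_left
  obtain ⟨p, ⟨hp, hfp⟩, hmin⟩ := hK.exists_isLeast ⟨b, right_mem_Icc.2 hcb, hb⟩
  refine ⟨p, hp.1.lt_of_ne ?_, hp.2, hfp, fun r hr hfr => ?_⟩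
  · rintro rfl
    exact hc hfp
  · exact hr.2.not_ge (hmin ⟨⟨hr.1, hr.2.le.trans hp.2⟩, hfr⟩)

section Comparison

variable {V φ φ' ψ ψ' : ℝ → ℝ} {μ : ℝ}

lemma continuousOn_wronskian (hφ : IsSolution V φ φ')
    (hψ : IsSolution (fun r => V r + μ) ψ ψ') :
    ContinuousOn (fun r => φ r * ψ' r - φ' r * ψ r) (Ici 1) :=
  (hφ.continuousOn.mul hψ.continuousOn_deriv).sub (hφ.continuousOn_deriv.mul hψ.continuousOn)

lemma hasDerivAt_wronskian (hφ : IsSolution V φ φ')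
    (hψ : IsSolution (fun r => V r + μ) ψ ψ') {r : ℝ} (hr : 1 < r) :
    HasDerivAt (fun r => φ r * ψ' r - φ' r * ψ r) (-μ * (φ r * ψ r)) r := by
  refine HasDerivAt.congr_deriv (((hφ.hasDerivAt hr).mul (hψ.deriv_deriv r hr)).sub
    ((hφ.deriv_deriv r hr).mul (hψ.hasDerivAt hr))) ?_
  ring

lemma strictMonoOn_wronskian (hφ : IsSolution V φ φ')
    (hψ : IsSolution (fun r => V r + μ) ψ ψ') (hμ : μ < 0) {s : Set ℝ} (hs : Convex ℝ s)
    (hs1 : s ⊆ Ici 1) (hpos : ∀ r ∈ interior s, 0 < φ r ∧ 0 < ψ r) :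
    StrictMonoOn (fun r => φ r * ψ' r - φ' r * ψ r) s := by
  refine strictMonoOn_of_hasDerivWithinAt_pos hs ((continuousOn_wronskian hφ hψ).mono hs1)
    (f' := fun r => -μ * (φ r * ψ r)) (fun r hr => ?_) (fun r hr => ?_)
  · have hr1 : r ∈ interior (Ici (1 : ℝ)) := interior_mono hs1 hr
    rw [interior_Ici] at hr1
    exact (hasDerivAt_wronskian hφ hψ hr1).hasDerivWithinAt
  · exact mul_pos (neg_pos.2 hμ) (mul_pos (hpos r hr).1 (hpos r hr).2)

lemma false_of_pos_Ioo (hφ : IsSolution V φ φ')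
    (hψ : IsSolution (fun r => V r + μ) ψ ψ') (hμ : μ < 0) {a b : ℝ} (ha : 1 ≤ a) (hab : a < b)
    (hψa : ψ a = 0) (hψb : ψ b = 0) (hφpos : ∀ r ∈ Ioo a b, 0 < φ r)
    (hψpos : ∀ r ∈ Ioo a b, 0 < ψ r) : False := by
  have hsub : Icc a b ⊆ Ici (1 : ℝ) := fun r hr => ha.trans hr.1
  have hW := strictMonoOn_wronskian hφ hψ hμ (convex_Icc a b) hsub
    (fun r hr => by rw [interior_Icc] at hr; exact ⟨hφpos r hr, hψpos r hr⟩)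
    (left_mem_Icc.2 hab.le) (right_mem_Icc.2 hab.le) hab
  have hφnonneg : ∀ r ∈ Icc a b, 0 ≤ φ r := by
    intro r hr
    rw [← closure_Ioo hab.ne] at hr
    refine ContinuousWithinAt.closure_le hr continuousWithinAt_const
      ((hφ.continuousOn r ?_).mono ?_) fun t ht => (hφpos t ht).le
    · rw [closure_Ioo hab.ne] at hr
      exact hsub hr
    · exact Ioo_subset_Icc_self.trans hsub
  have h1 := mul_nonneg (hφnonneg a (left_mem_Icc.2 hab.le))
    (hψ.deriv_nonneg_of_pos_right ha hab hψa hψpos)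
  have h2 := mul_nonpos_of_nonneg_of_nonpos (hφnonneg b (right_mem_Icc.2 hab.le))
    (hψ.deriv_nonpos_of_pos_left ha hab hψb hψpos)
  simp only [hψa, hψb, mul_zero, sub_zero] at hW
  linarith

lemma false_of_pos_Ioi (hφ : IsSolution V φ φ')
    (hψ : IsSolution (fun r => V r + μ) ψ ψ') (hμ : μ < 0) {ℓ : ℝ}
    (hlim : Tendsto φ atTop (nhds ℓ)) (hℓ : ℓ ≠ 0)
    (hint : IntegrableOn (fun r => ψ r ^ 2) (Ioi 1)) {a : ℝ} (ha : 1 ≤ a)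
    (hψa : ψ a = 0) (hφpos : ∀ r ∈ Ioi a, 0 < φ r) (hψpos : ∀ r ∈ Ioi a, 0 < ψ r) : False := by
  have hsub : Ici a ⊆ Ici (1 : ℝ) := Ici_subset_Ici.2 ha
  have hmono := strictMonoOn_wronskian hφ hψ hμ (convex_Ici a) hsub
    (fun r hr => by rw [interior_Ici] at hr; exact ⟨hφpos r hr, hψpos r hr⟩)
  have hφa : 0 ≤ φ a := by
    have ht : Tendsto φ (nhdsWithin a (Ioi a)) (nhds (φ a)) :=
      (hφ.continuousOn a ha).mono (Ioi_subset_Ici_self.trans hsub)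
    exact ge_of_tendsto ht (eventually_mem_nhdsWithin.mono fun r hr => (hφpos r hr).le)
  have hWa := mul_nonneg hφa (hψ.deriv_nonneg_of_pos_right ha (lt_add_one a) hψa
    fun r hr => hψpos r hr.1)
  have hℓpos : 0 < ℓ := lt_of_le_of_ne
    (ge_of_tendsto hlim ((eventually_gt_atTop a).mono fun r hr => (hφpos r hr).le)) hℓ.symm
  obtain ⟨R₀, hR₀⟩ := eventually_atTop.1
    ((hlim.eventually_lt_const (show ℓ < 2 * ℓ by linarith)).and
      (hlim.eventually_const_lt (show ℓ / 2 < ℓ by linarith)))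
  set R := max R₀ (a + 1) with hRdef
  have hRa : a < R := (lt_add_one a).trans_le (le_max_right _ _)
  set δ := φ R * ψ' R - φ' R * ψ R with hδdef
  have hδ : 0 < δ := by
    have := hmono self_mem_Ici hRa.le hRa
    simp only [hψa, mul_zero, sub_zero] at this
    linarith
  set ε := δ / (2 * ℓ) ^ 2 with hεdef
  have hε : 0 < ε := by positivity
  have hquot : ∀ r, a < r → HasDerivAt (fun r => ψ r / φ r)
      ((ψ' r * φ r - ψ r * φ' r) / φ r ^ 2) r := fun r hr =>
    (hψ.hasDerivAt (ha.trans_lt hr)).div (hφ.hasDerivAt (ha.trans_lt hr)) (hφpos r hr).ne'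
  have hgrow : MonotoneOn (fun r => ψ r / φ r - ε * r) (Ici R) := by
    have hd : ∀ r ∈ Ici R, HasDerivAt (fun r => ψ r / φ r - ε * r)
        ((ψ' r * φ r - ψ r * φ' r) / φ r ^ 2 - ε) r := fun r hr =>
      HasDerivAt.congr_deriv
        ((hquot r (hRa.trans_le hr)).sub ((hasDerivAt_id' r).const_mul ε)) (by rw [mul_one])
    refine monotoneOn_of_hasDerivWithinAt_nonneg (convex_Ici R)
      (fun r hr => (hd r hr).continuousAt.continuousWithinAt)
      (fun r hr => (hd r (interior_subset hr)).hasDerivWithinAt) (fun r hr => ?_)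
    have hr' : R ≤ r := interior_subset hr
    have hW : δ ≤ φ r * ψ' r - φ' r * ψ r :=
      hmono.monotoneOn hRa.le (hRa.le.trans hr') hr'
    have hφr := hφpos r (hRa.trans_le hr')
    have hφle := (hR₀ r ((le_max_left _ _).trans hr')).1
    rw [sub_nonneg, hεdef]
    exact div_le_div₀ (by linarith) (by linarith) (by positivity)
      (pow_le_pow_left₀ hφr.le hφle.le 2)
  have hlower : ∀ r ∈ Ici R, ε * (r - R) * (ℓ / 2) ≤ ψ r := by
    intro r hr
    have hr' : R ≤ r := hr
    have h1 : ψ R / φ R - ε * R ≤ ψ r / φ r - ε * r := hgrow self_mem_Ici hr hr'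
    have h2 : 0 < ψ R / φ R := div_pos (hψpos R hRa) (hφpos R hRa)
    have hφr := hφpos r (hRa.trans_le hr')
    have h3 : ε * (r - R) ≤ ψ r / φ r := by linarith
    have hφge := (hR₀ r ((le_max_left _ _).trans hr')).2
    calc ε * (r - R) * (ℓ / 2) ≤ ε * (r - R) * φ r := by
          have : 0 ≤ ε * (r - R) := mul_nonneg hε.le (by linarith)
          gcongr
      _ ≤ ψ r / φ r * φ r := by gcongr
      _ = ψ r := div_mul_cancel₀ _ hφr.ne'
  set T := R + 2 / (ε * ℓ) with hTdef
  have hRT : R ≤ T := by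
    have : 0 < 2 / (ε * ℓ) := by positivity
    linarith
  have hone : ∀ r ∈ Ioi T, 1 ≤ ψ r := by
    intro r hr
    have hr' : T < r := hr
    refine le_trans ?_ (hlower r (hRT.trans hr'.le))
    have h1 : 2 / (ε * ℓ) ≤ r - R := by linarith
    have h2 : ε * (2 / (ε * ℓ)) * (ℓ / 2) = 1 := by field_simp
    rw [← h2]
    gcongr
  have hTone : Ioi T ⊆ Ioi (1 : ℝ) := Ioi_subset_Ioi (by linarith)
  have hconst : IntegrableOn (fun _ : ℝ => (1 : ℝ)) (Ioi T) := by
    refine (hint.mono_set hTone).mono' aestronglyMeasurable_const ?_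
    refine (ae_restrict_iff' measurableSet_Ioi).2 (Eventually.of_forall fun r hr => ?_)
    rw [norm_one]
    nlinarith [hone r hr]
  rw [integrableOn_const_iff] at hconst
  simp at hconst

/-- Sturm comparison on a bounded interval. -/
lemma exists_zero_Ioo (hφ : IsSolution V φ φ')
    (hψ : IsSolution (fun r => V r + μ) ψ ψ') (hμ : μ < 0) (hV : ContinuousOn V (Ici 1))
    (hne : ∃ r ≥ (1 : ℝ), ψ r ≠ 0) {a b : ℝ} (ha : 1 ≤ a) (hab : a < b)
    (hψa : ψ a = 0) (hψb : ψ b = 0) : ∃ t ∈ Ioo a b, φ t = 0 := by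
  by_contra! hφne
  obtain ⟨c, hc, hψc⟩ := hψ.exists_ne_zero (hV.add continuousOn_const) hne ha hab
  have hac : Icc a c ⊆ Ici (1 : ℝ) := fun r hr => ha.trans hr.1
  have hcb : Icc c b ⊆ Ici (1 : ℝ) := fun r hr => ha.trans (hc.1.le.trans hr.1)
  obtain ⟨p, hap, hpc, hψp, hleft⟩ :=
    exists_last_zero (hψ.continuousOn.mono hac) hc.1.le hψa hψc
  obtain ⟨q, hcq, hqb, hψq, hright⟩ :=
    exists_first_zero (hψ.continuousOn.mono hcb) hc.2.le hψb hψc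
  have hp1 : 1 ≤ p := ha.trans hap
  have hpq : p < q := hpc.trans hcq
  have hsub : Ioo p q ⊆ Ici (1 : ℝ) := fun r hr => hp1.trans hr.1.le
  have hψne : ∀ r ∈ Ioo p q, ψ r ≠ 0 := fun r hr =>
    (le_total r c).elim (fun h => hleft r ⟨hr.1, h⟩) (fun h => hright r ⟨h, hr.2⟩)
  have hφne' : ∀ r ∈ Ioo p q, φ r ≠ 0 := fun r hr =>
    hφne r ⟨hap.trans_lt hr.1, hr.2.trans_le hqb⟩
  rcases pos_or_neg_of_ne_zero isPreconnected_Ioo (hφ.continuousOn.mono hsub) hφne' with h1 | h1 <;>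
  rcases pos_or_neg_of_ne_zero isPreconnected_Ioo (hψ.continuousOn.mono hsub) hψne with h2 | h2
  · exact false_of_pos_Ioo hφ hψ hμ hp1 hpq hψp hψq h1 h2
  · exact false_of_pos_Ioo hφ hψ.neg hμ hp1 hpq (by simp [hψp]) (by simp [hψq]) h1 h2
  · exact false_of_pos_Ioo hφ.neg hψ hμ hp1 hpq hψp hψq h1 h2
  · exact false_of_pos_Ioo hφ.neg hψ.neg hμ hp1 hpq (by simp [hψp]) (by simp [hψq]) h1 h2

/-- Sturm comparison on a half-line for square-integrable `ψ`. -/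
lemma exists_zero_Ioi (hφ : IsSolution V φ φ')
    (hψ : IsSolution (fun r => V r + μ) ψ ψ') (hμ : μ < 0) (hV : ContinuousOn V (Ici 1))
    (hne : ∃ r ≥ (1 : ℝ), ψ r ≠ 0) {ℓ : ℝ} (hlim : Tendsto φ atTop (nhds ℓ)) (hℓ : ℓ ≠ 0)
    (hint : IntegrableOn (fun r => ψ r ^ 2) (Ioi 1)) {a : ℝ} (ha : 1 ≤ a)
    (hψa : ψ a = 0) : ∃ t, a < t ∧ φ t = 0 := by
  by_cases hlast : ∃ b, a < b ∧ ψ b = 0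
  · obtain ⟨b, hab, hψb⟩ := hlast
    obtain ⟨t, ht, hφt⟩ := exists_zero_Ioo hφ hψ hμ hV hne ha hab hψa hψb
    exact ⟨t, ht.1, hφt⟩
  push Not at hlast
  by_contra! hφne
  have hsub : Ioi a ⊆ Ici (1 : ℝ) := fun r hr => ha.trans (le_of_lt hr)
  have hint' : IntegrableOn (fun r => (-ψ r) ^ 2) (Ioi 1) := by simpa using hint
  have hlim' : Tendsto (fun r => -φ r) atTop (nhds (-ℓ)) := hlim.neg
  rcases pos_or_neg_of_ne_zero isPreconnected_Ioi (hφ.continuousOn.mono hsub) hφne with h1 | h1 <;>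
  rcases pos_or_neg_of_ne_zero isPreconnected_Ioi (hψ.continuousOn.mono hsub) hlast with h2 | h2
  · exact false_of_pos_Ioi hφ hψ hμ hlim hℓ hint ha hψa h1 h2
  · exact false_of_pos_Ioi hφ hψ.neg hμ hlim hℓ hint' ha (by simp [hψa]) h1 h2
  · exact false_of_pos_Ioi hφ.neg hψ hμ hlim' (neg_ne_zero.2 hℓ) hint ha hψa h1 h2
  · exact false_of_pos_Ioi hφ.neg hψ.neg hμ hlim' (neg_ne_zero.2 hℓ) hint' ha (by simp [hψa]) h1 h2

end Comparison

/-- If every point of `A` is followed by a point of the finite set `B`, and any two points of `A`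
are separated by a point of `B`, then `A` has at most as many elements as `B`. -/
lemma finite_and_ncard_le_of_separated {A B : Set ℝ} (hB : B.Finite)
    (hsep : ∀ a ∈ A, ∀ b ∈ A, a < b → ∃ t ∈ B, a < t ∧ t < b)
    (hnext : ∀ a ∈ A, ∃ t ∈ B, a < t) : A.Finite ∧ A.ncard ≤ B.ncard := by
  have hleast : ∀ a, ∃ t, a ∈ A → IsLeast (B ∩ Ioi a) t := by
    intro a
    by_cases ha : a ∈ A
    · obtain ⟨t, htB, hat⟩ := hnext a ha
      have hfin : (B ∩ Ioi a).Finite := hB.subset inter_subset_left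
      obtain ⟨s, hs⟩ := hfin.isCompact.exists_isLeast ⟨t, htB, hat⟩
      exact ⟨s, fun _ => hs⟩
    · exact ⟨0, fun h => absurd h ha⟩
  choose f hf using hleast
  have hmaps : MapsTo f A B := fun a ha => (hf a ha).1.1
  have hmono : StrictMonoOn f A := by
    intro a ha b hb hab
    obtain ⟨t, htB, hat, htb⟩ := hsep a ha b hb hab
    exact ((hf a ha).2 ⟨htB, hat⟩).trans_lt (htb.trans (hf b hb).1.2)
  exact ⟨Finite.of_injOn hmaps hmono.injOn hB, ncard_le_ncard_of_injOn f hmaps hmono.injOn hB⟩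

/-- The function `r ↦ r (q / m + r q')` attached to a solution `q` of the Emden equation solves the
linearized equation. -/
lemma isSolution_scaling_generator {m : ℕ} (hm : m ≠ 0) {q q' : ℝ → ℝ}
    (hq : ∀ r, 0 < r → HasDerivAt q (q' r) r)
    (hq' : ∀ r, 0 < r → HasDerivAt q' (-(2 / r) * q' r - q r ^ (2 * m + 1)) r) :
    IsSolution (fun r => (2 * m + 1) * q r ^ (2 * m)) (fun r => r * (1 / (m : ℝ) * q r + r * q' r))
      (fun r => 1 / (m : ℝ) * q r + 1 / (m : ℝ) * (r * q' r) - r ^ 2 * q r ^ (2 * m + 1)) := by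
  have hm' : (m : ℝ) ≠ 0 := Nat.cast_ne_zero.2 hm
  have hd : ∀ r, 0 < r → HasDerivAt (fun r => r * (1 / (m : ℝ) * q r + r * q' r))
      (1 / (m : ℝ) * q r + 1 / (m : ℝ) * (r * q' r) - r ^ 2 * q r ^ (2 * m + 1)) r := by
    intro r hr
    refine HasDerivAt.congr_deriv ((hasDerivAt_id' r).mul
      (((hq r hr).const_mul (1 / (m : ℝ))).add ((hasDerivAt_id' r).mul (hq' r hr)))) ?_
    field_simp
    ring
  have hdd : ∀ r, 0 < r → HasDerivAt
      (fun r => 1 / (m : ℝ) * q r + 1 / (m : ℝ) * (r * q' r) - r ^ 2 * q r ^ (2 * m + 1))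
      (-((2 * m + 1) * q r ^ (2 * m)) * (r * (1 / (m : ℝ) * q r + r * q' r))) r := by
    intro r hr
    refine HasDerivAt.congr_deriv ((((hq r hr).const_mul (1 / (m : ℝ))).add
      (((hasDerivAt_id' r).mul (hq' r hr)).const_mul (1 / (m : ℝ)))).sub
      (((hasDerivAt_id' r).fun_pow 2).mul ((hq r hr).pow (2 * m + 1)))) ?_
    rw [Nat.add_sub_cancel, pow_succ (q r) (2 * m)]
    push_cast
    field_simp
    ring
  exact
    { deriv_within := fun r hr => (hd r (by linarith)).hasDerivWithinAt
      continuousOn_deriv := fun r hr =>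
        (hdd r (zero_lt_one.trans_le hr)).continuousAt.continuousWithinAt
      deriv_deriv := fun r hr => hdd r (by linarith) }

lemma isSolution_of_contDiffOn {P y : ℝ → ℝ} (hy : ContDiffOn ℝ 2 y (Ici 1))
    (hode : ∀ r > (1 : ℝ), deriv (deriv y) r = -(P r) * y r) :
    IsSolution P y (derivWithin y (Ici 1)) := by
  have heq : ∀ r, 1 < r → derivWithin y (Ici 1) =ᶠ[nhds r] deriv y := fun r hr => by
    filter_upwards [Ioi_mem_nhds hr] with t ht
    exact derivWithin_of_mem_nhds (Ici_mem_nhds ht)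
  have hC1 : ContDiffOn ℝ 1 (derivWithin y (Ici 1)) (Ici 1) :=
    hy.derivWithin (uniqueDiffOn_Ici 1) (by norm_num)
  refine ⟨fun r hr => ((hy.differentiableOn (by norm_num)) r hr).hasDerivWithinAt,
    hC1.continuousOn, fun r hr => ?_⟩
  have hdiff : DifferentiableAt ℝ (derivWithin y (Ici 1)) r :=
    (hC1.contDiffAt (Ici_mem_nhds hr)).differentiableAt (by norm_num)
  rw [← hode r hr, ← (heq r hr).deriv_eq]
  exact hdiff.hasDerivAt

/-- Sturm comparison — the number of zeros in $(1,∞)$ of an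
eigenfunction $ψ$ of $L_j$ is at most the number of zeros of $ΛQ_j$ minus one. -/
theorem stmt_10
    (m : ℕ) (hm : 2 < m)
    (Z : ℝ → ℝ) (rs : ℕ → ℝ)
    (hZreg : ContDiffOn ℝ 2 Z (Set.Ioi 0))
    (hZode : ∀ r > (0:ℝ), deriv (deriv Z) r + (2 / r) * deriv Z r + Z r ^ (2 * m + 1) = 0)
    (hZdecay : ∃ C > (0:ℝ), ∀ r ≥ (1:ℝ), |r * Z r - 1| ≤ C / r ^ 2)
    (hZderiv : Filter.Tendsto (fun r => r ^ 2 * deriv Z r) Filter.atTop (nhds (-1)))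
    (hrs_pos : ∀ j, 0 < rs j)
    (hrs_anti : StrictAnti rs)
    (hrs_lim : Filter.Tendsto rs Filter.atTop (nhds 0))
    (hrs_zeros : {r : ℝ | 0 < r ∧ Z r = 0} = Set.range rs)
    (Q : ℕ → ℝ → ℝ)
    (hQ : ∀ j r, Q j r = rs j ^ ((1:ℝ) / (m:ℝ)) * Z (rs j * r))
    (j : ℕ) (μ : ℝ) (hμ : μ < 0)
    (ψ : ℝ → ℝ)
    (hψne : ∃ r ≥ (1:ℝ), ψ r ≠ 0)
    (hψreg : ContDiffOn ℝ 2 ψ (Set.Ici 1))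
    (hψ1 : ψ 1 = 0)
    (hψint : MeasureTheory.IntegrableOn (fun r => ψ r ^ 2) (Set.Ioi 1))
    (hψode : ∀ r > (1:ℝ), deriv (deriv ψ) r + (2 * m + 1) * Q j r ^ (2 * m) * ψ r + μ * ψ r = 0) :
    {r : ℝ | 1 < r ∧ ψ r = 0}.Finite ∧
    {r : ℝ | 1 < r ∧ (1 / (m:ℝ)) * Q j r + r * deriv (Q j) r = 0}.Finite ∧
    {r : ℝ | 1 < r ∧ ψ r = 0}.ncard + 1
      ≤ {r : ℝ | 1 < r ∧ (1 / (m:ℝ)) * Q j r + r * deriv (Q j) r = 0}.ncard := by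
  have hm0 : m ≠ 0 := by omega
  have hmR : (2 : ℝ) < m := by exact_mod_cast hm
  set ρ := rs j with hρdef
  have hρ : 0 < ρ := hrs_pos j
  set κ := ρ ^ ((1 : ℝ) / (m : ℝ)) with hκdef
  have hκ : 0 < κ := Real.rpow_pos_of_pos hρ _
  have hκpow : κ ^ (2 * m) = ρ ^ 2 := by
    have : κ ^ m = ρ := by
      rw [hκdef, one_div]
      exact Real.rpow_inv_natCast_pow hρ.le hm0
    rw [mul_comm, pow_mul, this]
  have hQj : Q j = fun r => κ * Z (ρ * r) := funext (hQ j)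
  have hZd : ∀ r, 0 < r → HasDerivAt Z (deriv Z r) r := fun r hr =>
    ((hZreg.contDiffAt (Ioi_mem_nhds hr)).differentiableAt (by norm_num)).hasDerivAt
  have hZdd : ∀ r, 0 < r → HasDerivAt (deriv Z) (deriv (deriv Z) r) r := fun r hr =>
    (((hZreg.deriv_of_isOpen (m := 1) isOpen_Ioi (by norm_num)).contDiffAt
      (Ioi_mem_nhds hr)).differentiableAt (by norm_num)).hasDerivAt
  have hmul : ∀ r : ℝ, HasDerivAt (fun r => ρ * r) ρ r := fun r => by
    simpa using (hasDerivAt_id' r).const_mul ρ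
  have hq : ∀ r, 0 < r → HasDerivAt (Q j) (κ * ρ * deriv Z (ρ * r)) r := by
    intro r hr
    rw [hQj]
    refine HasDerivAt.congr_deriv (((hZd (ρ * r) (by positivity)).comp r (hmul r)).const_mul κ) ?_
    ring
  have hq' : ∀ r, 0 < r → HasDerivAt (fun r => κ * ρ * deriv Z (ρ * r))
      (-(2 / r) * (κ * ρ * deriv Z (ρ * r)) - Q j r ^ (2 * m + 1)) r := by
    intro r hr
    refine HasDerivAt.congr_deriv
      (((hZdd (ρ * r) (by positivity)).comp r (hmul r)).const_mul (κ * ρ)) ?_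
    have hode := hZode (ρ * r) (by positivity)
    have hsecond : deriv (deriv Z) (ρ * r) =
        -(2 / (ρ * r)) * deriv Z (ρ * r) - Z (ρ * r) ^ (2 * m + 1) := by linarith
    rw [hsecond, hQj]
    simp only [mul_pow]
    rw [pow_succ κ, hκpow]
    field_simp
  have hφ := isSolution_scaling_generator hm0 hq hq'
  have hzeros : {r : ℝ | 1 < r ∧ (1 / (m:ℝ)) * Q j r + r * deriv (Q j) r = 0} =
      {r : ℝ | 1 < r ∧ r * (1 / (m : ℝ) * Q j r + r * (κ * ρ * deriv Z (ρ * r))) = 0} := by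
    ext r
    refine and_congr_right fun hr => ?_
    have hr0 : 0 < r := by linarith
    rw [(hq r hr0).deriv, mul_eq_zero, or_iff_right hr0.ne']
  have hρr : Tendsto (fun r : ℝ => ρ * r) atTop atTop := tendsto_id.const_mul_atTop hρ
  have hrZ : Tendsto (fun r => r * Z r) atTop (nhds 1) := by
    obtain ⟨C, -, hC⟩ := hZdecay
    rw [tendsto_iff_norm_sub_tendsto_zero]
    refine squeeze_zero' (Eventually.of_forall fun _ => norm_nonneg _)
      ((eventually_ge_atTop 1).mono hC) ?_
    exact (tendsto_pow_atTop two_ne_zero).const_div_atTop C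
  have hlim : Tendsto (fun r => r * (1 / (m : ℝ) * Q j r + r * (κ * ρ * deriv Z (ρ * r)))) atTop
      (nhds (κ / ρ * (1 / m) * 1 + κ / ρ * (-1))) := by
    refine (((hrZ.comp hρr).const_mul (κ / ρ * (1 / (m : ℝ)))).add
      ((hZderiv.comp hρr).const_mul (κ / ρ))).congr fun r => ?_
    simp only [hQj, Function.comp_apply]
    field_simp
  have hℓ : κ / ρ * (1 / (m : ℝ)) * 1 + κ / ρ * (-1) ≠ 0 := by
    have h1 : 1 / (m : ℝ) < 1 := by
      rw [div_lt_one (by linarith)]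
      linarith
    have h2 : 0 < κ / ρ := by positivity
    nlinarith
  have hV : ContinuousOn (fun r => (2 * m + 1) * Q j r ^ (2 * m)) (Ici 1) := by
    have hQc : ContinuousOn (Q j) (Ici 1) := fun r hr =>
      (hq r (zero_lt_one.trans_le hr)).continuousAt.continuousWithinAt
    exact continuousOn_const.mul (hQc.pow _)
  have hψ : IsSolution (fun r => (2 * m + 1) * Q j r ^ (2 * m) + μ) ψ (derivWithin ψ (Ici 1)) :=
    isSolution_of_contDiffOn hψreg fun r hr => by linarith [hψode r hr]
  rw [hzeros]
  have hfin := hφ.finite_zeros hV hℓ hlim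
  set B := {r : ℝ | 1 < r ∧ r * (1 / (m : ℝ) * Q j r + r * (κ * ρ * deriv Z (ρ * r))) = 0}
  have hA : ∀ a ∈ insert 1 {r : ℝ | 1 < r ∧ ψ r = 0}, 1 ≤ a ∧ ψ a = 0 := by
    rintro a (rfl | ha)
    · exact ⟨le_rfl, hψ1⟩
    · exact ⟨ha.1.le, ha.2⟩
  obtain ⟨hAfin, hcard⟩ := finite_and_ncard_le_of_separated hfin
    (A := insert 1 {r : ℝ | 1 < r ∧ ψ r = 0})
    (fun a ha b hb hab => by
      obtain ⟨t, ht, hφt⟩ :=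
        exists_zero_Ioo hφ hψ hμ hV hψne (hA a ha).1 hab (hA a ha).2 (hA b hb).2
      exact ⟨t, ⟨(hA a ha).1.trans_lt ht.1, hφt⟩, ht⟩)
    (fun a ha => by
      obtain ⟨t, hat, hφt⟩ :=
        exists_zero_Ioi hφ hψ hμ hV hψne hlim hℓ hψint (hA a ha).1 (hA a ha).2
      exact ⟨t, ⟨(hA a ha).1.trans_lt hat, hφt⟩, hat⟩)
  have hψfin := hAfin.subset (subset_insert _ _)
  refine ⟨hψfin, hfin, ?_⟩
  rwa [ncard_insert_of_notMem (by simp) hψfin] at hcard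
end

section
/- Let j, k ∈ ℕ with 0 ≤ j ≤ k. Then: (i) there exists a₁ > 1 such that Q_k(a₁) > −Q_j(a₁); (ii) if (j,k) ≠ (0,0), there exists a₂ > 1 such that −Q_k(a₂) > Q_j(a₂); (iii) if j < k, there exists a₃ > 1 such that Q_k(a₃) > Q_j(a₃); (iv) if j < k, there exists a₄ > 1 such that −Q_k(a₄) > −Q_j(a₄). -/
open Set Filter MeasureTheory

/-- If `Z` is positive between two zeros and its flux `s ^ 2 * Z'` has derivative
`-s ^ 2 * Z ^ (2 * m + 1)`, then `Z` has nonzero slopes of the expected signs at these zeros. -/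
lemma deriv_signs_of_pos_between_zeros {m : ℕ} {Z D : ℝ → ℝ} {a b : ℝ} (ha : 0 < a) (hab : a < b)
    (hZ : ∀ s ∈ Icc a b, HasDerivAt Z (D s) s)
    (hflux : ∀ s ∈ Icc a b, HasDerivAt (fun s => s ^ 2 * D s) (-(s ^ 2 * Z s ^ (2 * m + 1))) s)
    (hZa : Z a = 0) (hZb : Z b = 0) (hpos : ∀ s ∈ Ioo a b, 0 < Z s) :
    0 < D a ∧ D b < 0 := by
  have hcont : ContinuousOn (fun s => s ^ 2 * D s) (Icc a b) :=
    fun s hs => (hflux s hs).continuousAt.continuousWithinAt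
  have hanti : StrictAntiOn (fun s => s ^ 2 * D s) (Icc a b) := by
    refine strictAntiOn_of_deriv_neg (convex_Icc a b) hcont fun s hs => ?_
    rw [interior_Icc] at hs
    rw [(hflux s (Ioo_subset_Icc_self hs)).deriv]
    have h1 := hpos s hs
    have h2 : 0 < s := ha.trans hs.1
    have : 0 < s ^ 2 * Z s ^ (2 * m + 1) := by positivity
    linarith
  obtain ⟨c, hc, hDc⟩ := exists_hasDerivAt_eq_zero hab
    (fun s hs => (hZ s hs).continuousAt.continuousWithinAt) (hZa.trans hZb.symm)
    (fun s hs => hZ s (Ioo_subset_Icc_self hs))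
  have hac := hanti (left_mem_Icc.2 hab.le) (Ioo_subset_Icc_self hc) hc.1
  have hcb := hanti (Ioo_subset_Icc_self hc) (right_mem_Icc.2 hab.le) hc.2
  simp only [hDc, mul_zero] at hac hcb
  exact ⟨pos_of_mul_pos_right hac (sq_nonneg a),
    neg_of_mul_neg_right hcb (sq_nonneg b)⟩

/-- Sturm comparison: a solution `Y` that is positive at the right end of a negative arch of the
solution `Z` cannot dominate `-Z` throughout this arch. -/
lemma exists_add_neg_of_neg_between_zeros {m : ℕ} {Z D Y E : ℝ → ℝ} {a b : ℝ}
    (ha : 0 < a) (hab : a < b)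
    (hZ : ∀ s ∈ Icc a b, HasDerivAt Z (D s) s)
    (hZflux : ∀ s ∈ Icc a b, HasDerivAt (fun s => s ^ 2 * D s) (-(s ^ 2 * Z s ^ (2 * m + 1))) s)
    (hY : ∀ s ∈ Icc a b, HasDerivAt Y (E s) s)
    (hYflux : ∀ s ∈ Icc a b, HasDerivAt (fun s => s ^ 2 * E s) (-(s ^ 2 * Y s ^ (2 * m + 1))) s)
    (hZa : Z a = 0) (hZb : Z b = 0) (hneg : ∀ s ∈ Ioo a b, Z s < 0) (hYb : 0 < Y b) :
    ∃ s ∈ Ioo a b, Y s + Z s < 0 := by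
  by_contra! hge
  have hodd : Odd (2 * m + 1) := odd_two_mul_add_one m
  obtain ⟨hDa, hDb⟩ := deriv_signs_of_pos_between_zeros (m := m) (Z := fun s => -Z s)
    (D := fun s => -D s) ha hab (fun s hs => (hZ s hs).neg)
    (fun s hs => by
      have hf : (fun s => s ^ 2 * -D s) = -fun s => s ^ 2 * D s := by
        ext x
        simp
      rw [hf, hodd.neg_pow]
      exact (hZflux s hs).neg.congr_deriv (by ring))
    (by simp [hZa]) (by simp [hZb]) (fun s hs => by linarith [hneg s hs])
  have hYa : 0 ≤ Y a := by
    have hc : ContinuousOn (fun s => Y s + Z s) (closure (Ioo a b)) := by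
      rw [closure_Ioo hab.ne]
      exact fun s hs =>
        ((hY s hs).continuousAt.add (hZ s hs).continuousAt).continuousWithinAt
    have h := le_on_closure (f := fun _ => (0 : ℝ)) hge continuousOn_const hc
      (x := a) (by rw [closure_Ioo hab.ne]; exact left_mem_Icc.2 hab.le)
    simpa [hZa] using h
  have hW : ∀ s ∈ Icc a b, HasDerivAt (fun s => s ^ 2 * E s * Z s - Y s * (s ^ 2 * D s))
      (s ^ 2 * (Y s * -Z s) * (Y s ^ (2 * m) - Z s ^ (2 * m))) s := fun s hs => by
    exact (((hYflux s hs).mul (hZ s hs)).sub ((hY s hs).mul (hZflux s hs))).congr_deriv (by ring)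
  have hmono : MonotoneOn (fun s => s ^ 2 * E s * Z s - Y s * (s ^ 2 * D s)) (Icc a b) := by
    refine monotoneOn_of_deriv_nonneg (convex_Icc a b)
      (fun s hs => (hW s hs).continuousAt.continuousWithinAt)
      (fun s hs => (hW s (interior_subset hs)).differentiableAt.differentiableWithinAt)
      fun s hs => ?_
    rw [interior_Icc] at hs
    rw [(hW s (Ioo_subset_Icc_self hs)).deriv]
    have h1 := hneg s hs
    have h2 := hge s hs
    have h3 : Z s ^ (2 * m) ≤ Y s ^ (2 * m) := by
      rw [← (even_two_mul m).neg_pow (Z s)]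
      exact pow_le_pow_left₀ (by linarith) (by linarith) _
    exact mul_nonneg (mul_nonneg (sq_nonneg s) (mul_nonneg (by linarith) (by linarith)))
      (by linarith)
  have h := hmono (left_mem_Icc.2 hab.le) (right_mem_Icc.2 hab.le) hab.le
  simp only [hZa, hZb, mul_zero, zero_sub] at h
  have hb : 0 < b := ha.trans hab
  have h1 : 0 ≤ Y a * (a ^ 2 * -D a) := by positivity
  have h2 : 0 < Y b * (b ^ 2 * D b) := by
    have : 0 < D b := by linarith
    positivity
  linarith

/-- pointwise inequalities between stationary solutions
(no stationary solution lies everywhere below another one, in the listed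
configurations). -/
theorem stmt_11
    (m : ℕ) (hm : 2 < m)
    (Z : ℝ → ℝ) (rs : ℕ → ℝ)
    (hZreg : ContDiffOn ℝ 2 Z (Set.Ioi 0))
    (hZode : ∀ r > (0:ℝ), deriv (deriv Z) r + (2 / r) * deriv Z r + Z r ^ (2 * m + 1) = 0)
    (hZdecay : ∃ C > (0:ℝ), ∀ r ≥ (1:ℝ), |r * Z r - 1| ≤ C / r ^ 2)
    (hZderiv : Filter.Tendsto (fun r => r ^ 2 * deriv Z r) Filter.atTop (nhds (-1)))
    (hrs_pos : ∀ j, 0 < rs j)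
    (hrs_anti : StrictAnti rs)
    (hrs_lim : Filter.Tendsto rs Filter.atTop (nhds 0))
    (hrs_zeros : {r : ℝ | 0 < r ∧ Z r = 0} = Set.range rs)
    (Q : ℕ → ℝ → ℝ)
    (hQ : ∀ j r, Q j r = rs j ^ ((1:ℝ) / (m:ℝ)) * Z (rs j * r))
    (j k : ℕ) (hjk : j ≤ k) :
    (∃ a > (1:ℝ), Q k a > - Q j a) ∧
    ((j, k) ≠ (0, 0) → ∃ a > (1:ℝ), - Q k a > Q j a) ∧
    (j < k → ∃ a > (1:ℝ), Q k a > Q j a) ∧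
    (j < k → ∃ a > (1:ℝ), - Q k a > - Q j a) := by
  have hZ : ∀ s > 0, HasDerivAt Z (deriv Z s) s := fun s hs =>
    ((hZreg.differentiableOn (by norm_num)).differentiableAt (Ioi_mem_nhds hs)).hasDerivAt
  have hD : ∀ s > 0, HasDerivAt (deriv Z) (deriv (deriv Z) s) s := fun s hs => by
    have h : ContDiffOn ℝ 1 (deriv Z) (Ioi 0) :=
      hZreg.deriv_of_isOpen isOpen_Ioi (by norm_num)
    exact ((h.differentiableOn (by norm_num)).differentiableAt (Ioi_mem_nhds hs)).hasDerivAt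
  have hflux : ∀ s > 0,
      HasDerivAt (fun s => s ^ 2 * deriv Z s) (-(s ^ 2 * Z s ^ (2 * m + 1))) s := fun s hs => by
    refine ((hasDerivAt_pow 2 s).mul (hD s hs)).congr_deriv ?_
    have h := hZode s hs
    field_simp at h
    push_cast
    linear_combination s * h
  have hzero : ∀ i, Z (rs i) = 0 := fun i => by
    have : rs i ∈ {r : ℝ | 0 < r ∧ Z r = 0} := hrs_zeros ▸ mem_range_self i
    exact this.2
  have hzero' : ∀ s > 0, Z s = 0 → ∃ i, rs i = s := fun s hs h => by
    have : s ∈ range rs := hrs_zeros ▸ (⟨hs, h⟩ : s ∈ {r : ℝ | 0 < r ∧ Z r = 0})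
    exact this
  have hlim : Tendsto (fun r => r * Z r) atTop (nhds 1) := by
    obtain ⟨C, -, hC⟩ := hZdecay
    rw [tendsto_iff_norm_sub_tendsto_zero]
    have h0 : Tendsto (fun r : ℝ => C / r ^ 2) atTop (nhds 0) :=
      tendsto_const_nhds.div_atTop (tendsto_pow_atTop (by norm_num))
    exact squeeze_zero' (Eventually.of_forall fun _ => norm_nonneg _)
      ((eventually_ge_atTop 1).mono fun r hr => hC r hr) h0
  have hcont : ContinuousOn Z (Ioi 0) := hZreg.continuousOn
  -- `Z` is positive beyond its largest zero
  have hpos : ∀ s, rs 0 < s → 0 < Z s := fun s hs => by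
    by_contra! hle
    have hs0 : 0 < s := (hrs_pos 0).trans hs
    obtain ⟨t, ht, hst⟩ := ((hlim.eventually (lt_mem_nhds one_pos)).and
      (eventually_gt_atTop s)).exists
    have hZt : 0 < Z t := pos_of_mul_pos_right ht (hs0.trans hst).le
    obtain ⟨c, hc, hZc⟩ := intermediate_value_Icc hst.le
      (hcont.mono fun x hx => hs0.trans_le hx.1) ⟨hle, hZt.le⟩
    obtain ⟨i, hi⟩ := hzero' c (hs0.trans_le hc.1) hZc
    linarith [hrs_anti.antitone (Nat.zero_le i), hc.1]
  have h10 : rs 1 < rs 0 := hrs_anti one_pos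
  have hne : ∀ s ∈ Ioo (rs 1) (rs 0), Z s ≠ 0 := fun s hs h => by
    obtain ⟨i, rfl⟩ := hzero' s ((hrs_pos 1).trans hs.1) h
    have h1 := hrs_anti.lt_iff_gt.1 hs.1
    have h2 := hrs_anti.lt_iff_gt.1 hs.2
    omega
  have hIcc : ∀ s ∈ Icc (rs 1) (rs 0), 0 < s := fun s hs => (hrs_pos 1).trans_le hs.1
  -- `Z` is negative between its two largest zeros
  have hneg : ∀ s ∈ Ioo (rs 1) (rs 0), Z s < 0 := by
    by_contra! hex
    obtain ⟨t, ht, hZt⟩ := hex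
    have hall : ∀ s ∈ Ioo (rs 1) (rs 0), 0 < Z s := fun s hs => by
      by_contra! hle
      have himg : (0 : ℝ) ∈ Z '' Ioo (rs 1) (rs 0) :=
        ((isPreconnected_Ioo.image Z (hcont.mono fun x hx =>
          hIcc x (Ioo_subset_Icc_self hx))).ordConnected).out
          (mem_image_of_mem Z hs) (mem_image_of_mem Z ht) ⟨hle, hZt⟩
      obtain ⟨c, hc, hZc⟩ := himg
      exact hne c hc hZc
    have hD0 := (deriv_signs_of_pos_between_zeros (hrs_pos 1) h10 (fun s hs => hZ s (hIcc s hs))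
      (fun s hs => hflux s (hIcc s hs)) (hzero 1) (hzero 0) hall).2
    have hmin : IsLocalMin Z (rs 0) := by
      filter_upwards [Ioi_mem_nhds h10] with s hs
      rw [hzero 0]
      rcases lt_trichotomy s (rs 0) with h | h | h
      · exact (hall s ⟨hs, h⟩).le
      · rw [h, hzero 0]
      · exact (hpos s h).le
    exact hD0.ne hmin.deriv_eq_zero
  have hQlim : ∀ i, Tendsto (fun r => r * Q i r) atTop
      (nhds (rs i ^ ((1 : ℝ) / m - 1))) := fun i => by
    have h := (hlim.comp (tendsto_id.const_mul_atTop (hrs_pos i))).const_mul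
      (rs i ^ ((1 : ℝ) / m - 1))
    rw [mul_one] at h
    refine h.congr fun r => ?_
    have := (hrs_pos i).ne'
    rw [hQ, Real.rpow_sub_one this]
    simp only [Function.comp_apply, id]
    field_simp
  have hm1 : (1 : ℝ) / m - 1 < 0 := by
    have : (2 : ℝ) < m := by exact_mod_cast hm
    rw [sub_neg, div_lt_one] <;> linarith
  refine ⟨?_, ?_, fun hlt => ?_, fun hlt => ?_⟩
  · have h := (hQlim k).add (hQlim j)
    have hp : 0 < rs k ^ ((1 : ℝ) / m - 1) + rs j ^ ((1 : ℝ) / m - 1) :=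
      add_pos (Real.rpow_pos_of_pos (hrs_pos k) _) (Real.rpow_pos_of_pos (hrs_pos j) _)
    obtain ⟨a, ha, ha1⟩ := ((h.eventually (lt_mem_nhds hp)).and (eventually_gt_atTop 1)).exists
    refine ⟨a, ha1, ?_⟩
    rw [← mul_add] at ha
    linarith [pos_of_mul_pos_right ha (by linarith)]
  · intro hjk0
    have hk : 1 ≤ k := by
      by_contra! h
      exact hjk0 (by ext <;> simp <;> omega)
    have hkp := hrs_pos k
    suffices ∃ s ∈ Ioo (rs 1) (rs 0), Q j (s / rs k) + Q k (s / rs k) < 0 by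
      obtain ⟨s, hs, h⟩ := this
      refine ⟨s / rs k, ?_, by linarith⟩
      rw [gt_iff_lt, one_lt_div hkp]
      exact (hrs_anti.antitone hk).trans_lt hs.1
    have hcancel : ∀ s, rs k * (s / rs k) = s := fun s => by field_simp
    have hck : 0 < rs k ^ ((1 : ℝ) / m) := Real.rpow_pos_of_pos hkp _
    rcases hjk.eq_or_lt with rfl | hlt
    · obtain ⟨s, hs⟩ := nonempty_Ioo.2 h10
      refine ⟨s, hs, ?_⟩
      rw [hQ, hcancel]
      have := mul_neg_of_pos_of_neg hck (hneg s hs)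
      linarith
    · obtain ⟨l, hl⟩ : ∃ l, l = rs j / rs k := ⟨_, rfl⟩
      have hl1 : 1 < l := by rw [hl, one_lt_div hkp]; exact hrs_anti hlt
      have hl0 : 0 < l := by linarith
      obtain ⟨c, hc⟩ : ∃ c, c = l ^ ((1 : ℝ) / m) := ⟨_, rfl⟩
      have hc0 : 0 < c := hc ▸ Real.rpow_pos_of_pos hl0 _
      have hcm : c ^ m = l := by
        rw [hc, one_div, Real.rpow_inv_natCast_pow hl0.le (by omega)]
      have hmul : ∀ s : ℝ, HasDerivAt (fun s => l * s) l s := fun s => by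
        simpa using (hasDerivAt_id s).const_mul l
      obtain ⟨s, hs, h⟩ := exists_add_neg_of_neg_between_zeros (m := m) (Y := fun s => c * Z (l * s))
        (E := fun s => c * (deriv Z (l * s) * l)) (hrs_pos 1) h10
        (fun s hs => hZ s (hIcc s hs)) (fun s hs => hflux s (hIcc s hs))
        (fun s hs => ((hZ (l * s) (mul_pos hl0 (hIcc s hs))).comp s (hmul s)).const_mul c)
        (fun s hs => by
          have hf : (fun s => s ^ 2 * (c * (deriv Z (l * s) * l))) =
              fun s => c / l * ((l * s) ^ 2 * deriv Z (l * s)) := by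
            ext x
            field_simp
          have hpow : (c * Z (l * s)) ^ (2 * m + 1) = l ^ 2 * c * Z (l * s) ^ (2 * m + 1) := by
            rw [mul_pow, pow_succ c, mul_comm 2 m, pow_mul c, hcm]
          rw [hf, hpow]
          refine (((hflux (l * s) (mul_pos hl0 (hIcc s hs))).comp s (hmul s)).const_mul
            (c / l)).congr_deriv ?_
          field_simp)
        (hzero 1) (hzero 0) hneg
        (mul_pos hc0 (hpos _ (lt_mul_of_one_lt_left (hrs_pos 0) hl1)))
      refine ⟨s, hs, ?_⟩
      have hjc : rs j ^ ((1 : ℝ) / m) = rs k ^ ((1 : ℝ) / m) * c := by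
        rw [hc, ← Real.mul_rpow hkp.le hl0.le, hl, mul_div_cancel₀ _ hkp.ne']
      have hjs : rs j * (s / rs k) = l * s := by rw [hl]; ring
      rw [hQ, hQ, hcancel, hjs, hjc, mul_assoc, ← mul_add]
      exact mul_neg_of_pos_of_neg hck h
  · have h := (hQlim k).sub (hQlim j)
    have hp : 0 < rs k ^ ((1 : ℝ) / m - 1) - rs j ^ ((1 : ℝ) / m - 1) :=
      sub_pos.2 (Real.rpow_lt_rpow_of_neg (hrs_pos k) (hrs_anti hlt) hm1)
    obtain ⟨a, ha, ha1⟩ := ((h.eventually (lt_mem_nhds hp)).and (eventually_gt_atTop 1)).exists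
    refine ⟨a, ha1, ?_⟩
    rw [← mul_sub] at ha
    linarith [pos_of_mul_pos_right ha (by linarith)]
  · have hkp := hrs_pos k
    refine ⟨rs 0 / rs k, ?_, ?_⟩
    · rw [gt_iff_lt, one_lt_div hkp]
      exact hrs_anti (by omega)
    · rw [hQ, hQ, mul_div_cancel₀ _ hkp.ne', hzero 0, mul_zero, neg_zero, gt_iff_lt,
        neg_lt_zero]
      refine mul_pos (Real.rpow_pos_of_pos (hrs_pos j) _) (hpos _ ?_)
      rw [← mul_div_assoc, lt_div_iff₀ hkp, mul_comm]
      exact mul_lt_mul_of_pos_right (hrs_anti hlt) (hrs_pos 0)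
end

section
/- Let X be a real Banach space and Y, Z₁, Z₂ closed subspaces with X = Y ⊕ Z₁ ⊕ Z₂ (every element of X is uniquely the sum of elements of Y, Z₁ and Z₂), where dim Z₁ = p₁ ≥ 1 and dim Z₂ = p₂ ≥ 1 are finite. Let u ∈ X, let U be an open neighborhood of u in X, and for j = 1, 2 let V_j be an open neighborhood of 0 in Y ⊕ Z_j, let Θ_j : V_j → Z_{3−j} be a C^∞ map with Θ_j(0) = 0 and Θ_j'(0) = 0, and let M_j ⊆ X satisfy U ∩ M_j = { u + h + Θ_j(h) : h ∈ V_j }. Then there exist an open neighborhood U' of u in X, a real ε > 0, and a C^∞ map Θ : B_Y(ε) → Z₁ ⊕ Z₂ (where B_Y(ε) = { y ∈ Y : ‖y‖ < ε }) with Θ(0) = 0 and Θ'(0) = 0, such that U' ∩ M₁ ∩ M₂ = { u + y + Θ(y) : y ∈ B_Y(ε) }. In particular, in a neighborhood of u, M₁ ∩ M₂ is a smooth submanifold of X of codimension p₁ + p₂ with tangent space Y at u. -/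
open Set Filter

/-- Implicit function theorem at the origin: if `f : E × G → G` is smooth near `0`, vanishes at `0`
and has the second projection as derivative there, then near `0` its zero set is the graph of a
smooth function with vanishing value and derivative at `0`. -/
theorem exists_contDiffOn_graph_eq_zeroSet {E G : Type*}
    [NormedAddCommGroup E] [NormedSpace ℝ E] [CompleteSpace E]
    [NormedAddCommGroup G] [NormedSpace ℝ G] [CompleteSpace G]
    {f : E × G → G} {W : Set (E × G)} (hW : IsOpen W) (h0W : 0 ∈ W)
    (hf : ContDiffOn ℝ (⊤ : ℕ∞) f W) (hf0 : f 0 = 0)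
    (hf' : HasFDerivAt f (ContinuousLinearMap.snd ℝ E G) 0) :
    ∃ S ⊆ W, IsOpen S ∧ 0 ∈ S ∧ ∃ ε > (0 : ℝ), ∃ g : E → G,
      ContDiffOn ℝ (⊤ : ℕ∞) g (Metric.ball 0 ε) ∧ g 0 = 0 ∧
      HasFDerivAt g (0 : E →L[ℝ] G) 0 ∧
      ∀ y ∈ Metric.ball (0 : E) ε, (y, g y) ∈ S ∧ ∀ z, (y, z) ∈ S → (f (y, z) = 0 ↔ z = g y) := by
  have hn : ((⊤ : ℕ∞) : WithTop ℕ∞) ≠ 0 := by simp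
  let F : E × G → E × G := fun t => (t.1, f t)
  have hF : ContDiffOn ℝ (⊤ : ℕ∞) F W := contDiff_fst.contDiffOn.prodMk hf
  have hFat : ∀ t ∈ W, ContDiffAt ℝ (⊤ : ℕ∞) F t := fun t ht => hF.contDiffAt (hW.mem_nhds ht)
  have hF' : HasFDerivAt F (ContinuousLinearEquiv.refl ℝ (E × G) : E × G →L[ℝ] E × G) 0 :=
    hasFDerivAt_fst.prodMk hf'
  have hF0 : F 0 = 0 := by simp [F, hf0]
  let φ := (hFat 0 h0W).toOpenPartialHomeomorph F hF' hn
  have hφ : ∀ t, φ t = F t := fun _ => rfl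
  have hφ0 : (0 : E × G) ∈ φ.source :=
    (hFat 0 h0W).mem_toOpenPartialHomeomorph_source hF' hn
  have hsymm0 : φ.symm 0 = 0 := by
    simpa [hφ, hF0] using φ.left_inv hφ0
  have hcont : ContinuousOn (fderiv ℝ F) W := hF.continuousOn_fderiv_of_isOpen hW (by simp)
  let R : Set (E × G) := W ∩ fderiv ℝ F ⁻¹' {A | IsUnit A}
  have hR : IsOpen R := hcont.isOpen_inter_preimage hW Units.isOpen
  have h0R : (0 : E × G) ∈ R := by
    refine ⟨h0W, ?_⟩
    rw [mem_preimage, hF'.fderiv]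
    exact isUnit_one
  let S := φ.source ∩ R
  have hS : IsOpen S := φ.open_source.inter hR
  let T := φ.target ∩ φ.symm ⁻¹' R
  have hT : IsOpen T := φ.isOpen_inter_preimage_symm hR
  have h0T : (0 : E × G) ∈ T := by
    refine ⟨?_, ?_⟩
    · simpa [hφ, hF0] using φ.map_source hφ0
    · simpa [hsymm0] using h0R
  let ι : E →L[ℝ] E × G := ContinuousLinearMap.inl ℝ E G
  have hι0 : ι 0 = 0 := map_zero ι
  have hιT : IsOpen (ι ⁻¹' T) := hT.preimage ι.continuous
  obtain ⟨ε, hε, hball⟩ := Metric.isOpen_iff.1 hιT 0 (by rwa [mem_preimage, hι0])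
  have hsmooth : ∀ s ∈ T, ContDiffAt ℝ (⊤ : ℕ∞) φ.symm s := by
    rintro s ⟨hs, hsW, A, hA⟩
    refine φ.contDiffAt_symm (f₀' := ContinuousLinearEquiv.ofUnit A) hs ?_ (hFat _ hsW)
    have := ((hFat _ hsW).differentiableAt hn).hasFDerivAt
    rw [← hA] at this
    exact this
  have hfst : ∀ s ∈ φ.target, (φ.symm s).1 = s.1 ∧ f (φ.symm s) = s.2 := fun s hs =>
    Prod.ext_iff.1 (φ.right_inv hs)
  refine ⟨S, fun t ht => ht.2.1, hS, ⟨hφ0, h0R⟩, ε, hε, fun y => (φ.symm (ι y)).2, ?_, ?_, ?_, ?_⟩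
  · intro y hy
    exact (contDiff_snd.contDiffAt.comp y
      ((hsmooth _ (hball hy)).comp y ι.contDiff.contDiffAt)).contDiffWithinAt
  · simp [hsymm0]
  · have hd : HasFDerivAt φ.symm
        ((ContinuousLinearEquiv.refl ℝ (E × G)).symm : E × G →L[ℝ] E × G) (ι 0) :=
      φ.hasFDerivAt_symm (by rw [hι0]; exact h0T.1) (by rw [hι0, hsymm0]; exact hF')
    have := hasFDerivAt_snd.comp (𝕜 := ℝ) (0 : E) (hd.comp (0 : E) ι.hasFDerivAt)
    refine this.congr_fderiv ?_
    ext y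
    simp [ι]
  · intro y hy
    obtain ⟨hyt, hyR⟩ := hball hy
    obtain ⟨h1, h2⟩ := hfst _ hyt
    have hpair : (y, (φ.symm (ι y)).2) = φ.symm (ι y) := Prod.ext h1.symm rfl
    refine ⟨?_, fun z hz => ⟨fun h => ?_, ?_⟩⟩
    · rw [hpair]
      exact ⟨φ.map_target hyt, hyR⟩
    · have h3 : φ (y, z) = ι y := Prod.ext rfl h
      change z = (φ.symm (ι y)).2
      rw [← h3, φ.left_inv hz.1]
    · rintro rfl
      rw [hpair, h2]
      rfl

/-- If `P` and `Q` are disjoint, a point `u + (a + q)` with `a ∈ P` and `q ∈ Q` lies on the graph of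
`Θ : P → Q` over `V` based at `u` iff `a ∈ V` and `q = Θ a`. -/
theorem add_mem_image_graph_iff {X : Type*} [AddCommGroup X] [Module ℝ X] {P Q : Submodule ℝ X}
    (hPQ : Disjoint P Q) (u : X) (V : Set P) (Θ : P → Q) (a : P) (q : Q) :
    u + ((a : X) + q) ∈ (fun h : P => u + (h : X) + (Θ h : X)) '' V ↔ a ∈ V ∧ q = Θ a := by
  constructor
  · rintro ⟨h, hV, heq⟩
    have h1 : (h : X) + Θ h = a + q := by
      simpa [add_assoc] using heq
    have h2 : (h : X) - a = q - Θ h := by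
      rw [sub_eq_sub_iff_add_eq_add, h1, add_comm]
    have h3 : (h : X) - a = 0 := Submodule.disjoint_def.1 hPQ _ (P.sub_mem h.2 a.2)
      (h2 ▸ Q.sub_mem q.2 (Θ h).2)
    obtain rfl : h = a := Subtype.ext (sub_eq_zero.1 h3)
    exact ⟨hV, Subtype.ext (add_left_cancel h1).symm⟩
  · rintro ⟨ha, rfl⟩
    exact ⟨a, ha, by simp [add_assoc]⟩


/-- a transverse intersection of two graph submanifolds `M₁`
(graph over `Y ⊕ Z₁` with values in `Z₂`) and `M₂` (graph over `Y ⊕ Z₂` with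
values in `Z₁`) is, near the base point `u`, a graph over `Y` with values in
`Z₁ ⊕ Z₂`, with vanishing value and derivative at `u`. -/
theorem stmt_19 (X : Type*) [NormedAddCommGroup X] [NormedSpace ℝ X] [CompleteSpace X]
    (p₁ p₂ : ℕ) (hp₁ : 1 ≤ p₁) (hp₂ : 1 ≤ p₂)
    (Y Z₁ Z₂ : Submodule ℝ X)
    (hYc : IsClosed (Y : Set X)) (hZ₁c : IsClosed (Z₁ : Set X))
    (hZ₂c : IsClosed (Z₂ : Set X))
    (hdim₁ : Module.finrank ℝ Z₁ = p₁) (hdim₂ : Module.finrank ℝ Z₂ = p₂)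
    (hdirect : ∀ x : X, ∃! t : Y × Z₁ × Z₂,
      x = ((t.1 : X) + (t.2.1 : X)) + (t.2.2 : X))
    (u : X) (U : Set X) (hU : IsOpen U) (huU : u ∈ U)
    (V₁ : Set (Y ⊔ Z₁ : Submodule ℝ X)) (hV₁ : IsOpen V₁) (h0V₁ : 0 ∈ V₁)
    (V₂ : Set (Y ⊔ Z₂ : Submodule ℝ X)) (hV₂ : IsOpen V₂) (h0V₂ : 0 ∈ V₂)
    (Θ₁ : (Y ⊔ Z₁ : Submodule ℝ X) → Z₂)
    (hΘ₁ : ContDiffOn ℝ (⊤ : ℕ∞) Θ₁ V₁) (hΘ₁0 : Θ₁ 0 = 0) (hΘ₁'0 : fderiv ℝ Θ₁ 0 = 0)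
    (Θ₂ : (Y ⊔ Z₂ : Submodule ℝ X) → Z₁)
    (hΘ₂ : ContDiffOn ℝ (⊤ : ℕ∞) Θ₂ V₂) (hΘ₂0 : Θ₂ 0 = 0) (hΘ₂'0 : fderiv ℝ Θ₂ 0 = 0)
    (M₁ M₂ : Set X)
    (hM₁ : U ∩ M₁ = (fun h : (Y ⊔ Z₁ : Submodule ℝ X) =>
      u + (h : X) + ((Θ₁ h : Z₂) : X)) '' V₁)
    (hM₂ : U ∩ M₂ = (fun h : (Y ⊔ Z₂ : Submodule ℝ X) =>
      u + (h : X) + ((Θ₂ h : Z₁) : X)) '' V₂) :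
    ∃ U' : Set X, IsOpen U' ∧ u ∈ U' ∧
    ∃ ε > (0:ℝ), ∃ Θ : Y → (Z₁ ⊔ Z₂ : Submodule ℝ X),
      ContDiffOn ℝ (⊤ : ℕ∞) Θ (Metric.ball 0 ε) ∧ Θ 0 = 0 ∧ fderiv ℝ Θ 0 = 0 ∧
      U' ∩ (M₁ ∩ M₂) = (fun y : Y => u + (y : X) + ((Θ y : (Z₁ ⊔ Z₂ : Submodule ℝ X)) : X))
        '' Metric.ball 0 ε := by
  have : CompleteSpace Y := hYc.completeSpace_coe
  have : FiniteDimensional ℝ Z₁ := Module.finite_of_finrank_pos (by omega)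
  have : FiniteDimensional ℝ Z₂ := Module.finite_of_finrank_pos (by omega)
  have : CompleteSpace Z₁ := FiniteDimensional.complete ℝ Z₁
  have : CompleteSpace Z₂ := FiniteDimensional.complete ℝ Z₂
  let T₀ : Y × Z₁ × Z₂ →L[ℝ] X := Y.subtypeL.coprod (Z₁.subtypeL.coprod Z₂.subtypeL)
  have hT₀ : ∀ t, T₀ t = (t.1 : X) + (t.2.1 : X) + (t.2.2 : X) := fun t => (add_assoc _ _ _).symm
  have hinj : Function.Injective T₀ := fun s t hst =>
    (hdirect (T₀ s)).unique (hT₀ s) (hst.trans (hT₀ t))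
  have hsurj : Function.Surjective T₀ := fun x =>
    let ⟨t, ht, _⟩ := hdirect x
    ⟨t, (hT₀ t).trans ht.symm⟩
  let T : (Y × Z₁ × Z₂) ≃L[ℝ] X := ContinuousLinearEquiv.ofBijective T₀
    (LinearMap.ker_eq_bot.2 hinj) (LinearMap.range_eq_top.2 hsurj)
  have hT : ∀ t, T t = (t.1 : X) + (t.2.1 : X) + (t.2.2 : X) := hT₀
  have hdis₁ : Disjoint (Y ⊔ Z₁) Z₂ := by
    refine Submodule.disjoint_def.2 fun x hx hx' => ?_
    obtain ⟨y, hy, z, hz, rfl⟩ := Submodule.mem_sup.1 hx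
    have := @hinj (⟨y, hy⟩, ⟨z, hz⟩, 0) (0, 0, ⟨_, hx'⟩) (by simp [hT₀])
    simpa using (congrArg (fun t : Y × Z₁ × Z₂ => (t.2.2 : X)) this).symm
  have hdis₂ : Disjoint (Y ⊔ Z₂) Z₁ := by
    refine Submodule.disjoint_def.2 fun x hx hx' => ?_
    obtain ⟨y, hy, z, hz, rfl⟩ := Submodule.mem_sup.1 hx
    have := @hinj (⟨y, hy⟩, 0, ⟨z, hz⟩) (0, ⟨_, hx'⟩, 0) (by simp [hT₀])
    simpa using (congrArg (fun t : Y × Z₁ × Z₂ => (t.2.1 : X)) this).symm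
  let A₁ : Y × Z₁ × Z₂ →L[ℝ] (Y ⊔ Z₁ : Submodule ℝ X) :=
    (Y.subtypeL.coprod (Z₁.subtypeL.comp (ContinuousLinearMap.fst ℝ Z₁ Z₂))).codRestrict _
      fun t => Submodule.add_mem_sup t.1.2 t.2.1.2
  let A₂ : Y × Z₁ × Z₂ →L[ℝ] (Y ⊔ Z₂ : Submodule ℝ X) :=
    (Y.subtypeL.coprod (Z₂.subtypeL.comp (ContinuousLinearMap.snd ℝ Z₁ Z₂))).codRestrict _
      fun t => Submodule.add_mem_sup t.1.2 t.2.2.2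
  have hA₁ : ∀ t, (A₁ t : X) = (t.1 : X) + (t.2.1 : X) := fun _ => rfl
  have hA₂ : ∀ t, (A₂ t : X) = (t.1 : X) + (t.2.2 : X) := fun _ => rfl
  let B : Z₁ × Z₂ →L[ℝ] (Z₁ ⊔ Z₂ : Submodule ℝ X) :=
    (Z₁.subtypeL.coprod Z₂.subtypeL).codRestrict _ fun t => Submodule.add_mem_sup t.1.2 t.2.2
  have hB : ∀ z, (B z : X) = (z.1 : X) + (z.2 : X) := fun _ => rfl
  have hmem₁ : ∀ t, u + T t ∈ U → (u + T t ∈ M₁ ↔ A₁ t ∈ V₁ ∧ t.2.2 = Θ₁ (A₁ t)) := by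
    intro t ht
    rw [← add_mem_image_graph_iff hdis₁ u, ← hM₁, hA₁, ← hT]
    simp [ht]
  have hmem₂ : ∀ t, u + T t ∈ U → (u + T t ∈ M₂ ↔ A₂ t ∈ V₂ ∧ t.2.1 = Θ₂ (A₂ t)) := by
    intro t ht
    rw [← add_mem_image_graph_iff hdis₂ u, ← hM₂, hA₂, add_right_comm, ← hT]
    simp [ht]
  let f : Y × Z₁ × Z₂ → Z₁ × Z₂ := fun t => t.2 - (Θ₂ (A₂ t), Θ₁ (A₁ t))
  let W : Set (Y × Z₁ × Z₂) := (A₁ ⁻¹' V₁ ∩ A₂ ⁻¹' V₂) ∩ (fun t => u + T t) ⁻¹' U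
  have hW : IsOpen W := ((hV₁.preimage A₁.continuous).inter (hV₂.preimage A₂.continuous)).inter
    (hU.preimage (continuous_const.add T.continuous))
  have h0W : (0 : Y × Z₁ × Z₂) ∈ W := by
    refine ⟨⟨?_, ?_⟩, ?_⟩ <;> simpa
  have hfW : ContDiffOn ℝ (⊤ : ℕ∞) f W :=
    contDiff_snd.contDiffOn.sub
      ((hΘ₂.comp A₂.contDiff.contDiffOn fun t ht => ht.1.2).prodMk
        (hΘ₁.comp A₁.contDiff.contDiffOn fun t ht => ht.1.1))
  have hf0 : f 0 = 0 := by simp [f, hΘ₁0, hΘ₂0]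
  have hd₁ : HasFDerivAt Θ₁ (0 : _ →L[ℝ] Z₂) (A₁ 0) := by
    rw [map_zero, ← hΘ₁'0]
    exact ((hΘ₁.contDiffAt (hV₁.mem_nhds h0V₁)).differentiableAt (by simp)).hasFDerivAt
  have hd₂ : HasFDerivAt Θ₂ (0 : _ →L[ℝ] Z₁) (A₂ 0) := by
    rw [map_zero, ← hΘ₂'0]
    exact ((hΘ₂.contDiffAt (hV₂.mem_nhds h0V₂)).differentiableAt (by simp)).hasFDerivAt
  have hf' : HasFDerivAt f (ContinuousLinearMap.snd ℝ Y (Z₁ × Z₂)) 0 := by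
    have := (hasFDerivAt_snd (𝕜 := ℝ) (p := (0 : Y × Z₁ × Z₂))).sub
      ((hd₂.comp 0 A₂.hasFDerivAt).prodMk (hd₁.comp 0 A₁.hasFDerivAt))
    refine this.congr_fderiv ?_
    ext <;> simp
  have hiff : ∀ t ∈ W, (u + T t ∈ M₁ ∩ M₂ ↔ f t = 0) := by
    rintro t ⟨⟨h1, h2⟩, h3⟩
    rw [mem_inter_iff, hmem₁ t h3, hmem₂ t h3, sub_eq_zero, Prod.ext_iff]
    exact ⟨fun h => ⟨h.2.2, h.1.2⟩, fun h => ⟨⟨h1, h.2⟩, h2, h.1⟩⟩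
  obtain ⟨S, hSW, hS, h0S, ε, hε, g, hg, hg0, hg', hgS⟩ :=
    exists_contDiffOn_graph_eq_zeroSet hW h0W hfW hf0 hf'
  have hTB : ∀ y : Y, u + (y : X) + (B (g y) : X) = u + T (y, g y) := by
    intro y
    rw [hT, hB]
    simp only [add_assoc]
  refine ⟨(fun x => T.symm (x - u)) ⁻¹' (S ∩ Prod.fst ⁻¹' Metric.ball 0 ε), ?_, ?_, ε, hε,
    fun y => B (g y), B.contDiff.comp_contDiffOn hg, by simp [hg0], ?_, ?_⟩
  · exact (hS.inter (Metric.isOpen_ball.preimage continuous_fst)).preimage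
      (T.symm.continuous.comp (continuous_id.sub continuous_const))
  · simpa [h0S] using hε
  · exact (B.hasFDerivAt.comp (0 : Y) hg').fderiv.trans B.comp_zero
  · ext x
    constructor
    · rintro ⟨⟨hxS, hxε⟩, hx⟩
      obtain ⟨⟨y, z⟩, rfl⟩ : ∃ t, u + T t = x := ⟨T.symm (x - u), by simp⟩
      simp only [add_sub_cancel_left, T.symm_apply_apply] at hxS hxε
      obtain rfl := ((hgS y hxε).2 z hxS).1 ((hiff _ (hSW hxS)).1 hx)
      exact ⟨y, hxε, hTB y⟩
    · rintro ⟨y, hy, rfl⟩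
      obtain ⟨hyS, hyf⟩ := hgS y hy
      simp only [hTB]
      refine ⟨?_, (hiff _ (hSW hyS)).2 ((hyf _ hyS).2 rfl)⟩
      rw [mem_preimage, add_sub_cancel_left, T.symm_apply_apply]
      exact ⟨hyS, hy⟩
end
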